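/- arXiv:1604.07066 — 4 statements merged into one kernel-verified Lean document; each statement's English description precedes it below -/
import Mathlib

section
/- Let G be a finite group, H ≤ G, and let π = Ind_H^G(1) be the permutation character of G acting on the cosets of H. Let r+1 be the number of orbits of G on the set of unordered pairs of cosets (including 'diagonal' pairs {x,x}). Then r + 1 = (1/2)·Σ_{χ ∈ Irr G} m_χ·(m_χ + ν₂(χ)), where m_χ = ⟨π, χ⟩ and ν₂(χ) = (1/|G|)·Σ_{g∈G} χ(g²) is the Frobenius–Schur indicator. -/
/-- `χ : G → ℂ` is an irreducible complex character. -/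
def IsIrrChar (G : Type) [Group G] (χ : G → ℂ) : Prop :=
  ∃ (V : Type) (_ : AddCommGroup V) (_ : Module ℂ V) (_ : FiniteDimensional ℂ V)
    (τ : Representation ℂ G V), Nontrivial V ∧
      (∀ W : Submodule ℂ V, (∀ g, ∀ x ∈ W, τ g x ∈ W) → W = ⊥ ∨ W = ⊤) ∧
      ∀ g, χ g = LinearMap.trace ℂ V (τ g)

open Finset in
lemma aux_fix {X : Type} [Fintype X] [DecidableEq X] (σ : X → X) (hσ : Function.Injective σ) :
    2 * #{p : Sym2 X | Sym2.map σ p = p} = #{x : X | σ x = x} ^ 2 + #{x : X | σ (σ x) = x} := by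
  have key : ∀ p : Sym2 X,
      #{q ∈ ({x : X | σ x = x} : Finset X) ×ˢ ({x : X | σ x = x} : Finset X) | s(q.1, q.2) = p}
      + #{x ∈ ({x : X | σ (σ x) = x} : Finset X) | s(x, σ x) = p}
      = if Sym2.map σ p = p then 2 else 0 := by
    intro p
    induction p using Sym2.ind with
    | _ a b =>
    have h1 : ({q ∈ ({x : X | σ x = x} : Finset X) ×ˢ ({x : X | σ x = x} : Finset X) |
        s(q.1, q.2) = s(a, b)} : Finset (X × X))
        = if σ a = a ∧ σ b = b then {(a, b), (b, a)} else ∅ := by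
      ext ⟨x, y⟩
      split_ifs with h <;> simp [Sym2.eq_iff] <;> grind
    have h2 : ({x ∈ ({x : X | σ (σ x) = x} : Finset X) | s(x, σ x) = s(a, b)} : Finset X)
        = if σ a = b ∧ σ b = a then {a, b} else ∅ := by
      ext x
      split_ifs with h <;> simp [Sym2.eq_iff] <;> grind
    rw [h1, h2]
    simp only [Sym2.map_mk, Sym2.eq_iff]
    by_cases hab : a = b
    · subst hab
      by_cases h : σ a = a <;> simp [h]
    · by_cases h3 : σ a = a ∧ σ b = b
      · have h4 : ¬ (σ a = b ∧ σ b = a) := by grind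
        rw [if_pos h3, if_neg h4, if_pos (Or.inl h3), Finset.card_pair (by grind)]; simp
      · by_cases h4 : σ a = b ∧ σ b = a
        · rw [if_neg h3, if_pos h4, if_pos (Or.inr h4), Finset.card_pair (by grind)]; simp
        · simp [h3, h4]
  have := Finset.sum_congr (rfl : (univ : Finset (Sym2 X)) = univ) (fun p _ => key p)
  rw [Finset.sum_add_distrib, ← Finset.card_eq_sum_card_fiberwise (by simp [Set.MapsTo]),
    ← Finset.card_eq_sum_card_fiberwise (by simp [Set.MapsTo]), Finset.card_product,
    ← Finset.sum_filter, Finset.sum_const] at this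
  simp only [smul_eq_mul] at this
  rw [sq, this, mul_comm]

lemma aux_burnside {G : Type} [Group G] [Fintype G] (X : Type) [Fintype X] [MulAction G X] :
    (Nat.card (Quot (fun p q : Sym2 X =>
        ∃ g : G, Sym2.map (fun x => g • x) p = q)) : ℂ)
    = (1/2) * ((Fintype.card G : ℂ)⁻¹ * ∑ g : G, ((Nat.card {x : X // g • x = x} : ℂ) ^ 2
        + (Nat.card {x : X // (g ^ 2) • x = x} : ℂ))) := by
  classical
  letI : MulAction G (Sym2 X) :=
    { smul := fun g p => Sym2.map (fun x => g • x) p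
      one_smul := fun p => by
        change Sym2.map (fun x => (1 : G) • x) p = p
        simp
      mul_smul := fun g h p => by
        change Sym2.map (fun x => (g * h) • x) p = Sym2.map (fun x => g • x) (Sym2.map (fun x => h • x) p)
        rw [Sym2.map_map]; congr 1; ext x; simp [mul_smul] }
  have hB := MulAction.sum_card_fixedBy_eq_card_orbits_mul_card_group G (Sym2 X)
  have hq : Nat.card (Quot (fun p q : Sym2 X =>
        ∃ g : G, Sym2.map (fun x => g • x) p = q)) =
        Fintype.card (Quotient (MulAction.orbitRel G (Sym2 X))) := by
    rw [← Nat.card_eq_fintype_card]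
    refine Nat.card_congr (Quot.congr (Equiv.refl _) ?_)
    intro p q
    change _ ↔ (MulAction.orbitRel G (Sym2 X)) p q
    rw [Setoid.comm', MulAction.orbitRel_apply]
    rfl
  have hf : ∀ g : G, ((Nat.card {x : X // g • x = x} : ℂ) ^ 2
        + (Nat.card {x : X // (g ^ 2) • x = x} : ℂ)) =
        2 * (Fintype.card (MulAction.fixedBy (Sym2 X) g) : ℂ) := by
    intro g
    have h := aux_fix (fun x : X => g • x) (MulAction.injective g)
    have e : Fintype.card (MulAction.fixedBy (Sym2 X) g) =
      (Finset.univ.filter (fun p : Sym2 X => Sym2.map (fun x => g • x) p = p)).card := by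
      rw [← Fintype.card_subtype]
      exact Fintype.card_congr (Equiv.refl _)
    rw [e]
    simp only [Nat.card_eq_fintype_card, Fintype.card_subtype, sq g, mul_smul]
    exact_mod_cast h.symm
  rw [Finset.sum_congr rfl (fun g _ => hf g), ← Finset.mul_sum, hq]
  have hB' : (∑ g : G, (Fintype.card (MulAction.fixedBy (Sym2 X) g) : ℂ)) =
    Fintype.card (Quotient (MulAction.orbitRel G (Sym2 X))) * Fintype.card G := by
    exact_mod_cast hB
  rw [hB']
  have : (Fintype.card G : ℂ) ≠ 0 := by simp
  field_simp

open Matrix in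
open scoped ComplexOrder in
lemma aux_conj_matrix {G : Type} [Group G] [Fintype G] {n : Type} [Fintype n] [DecidableEq n]
    (ρ : G →* Matrix n n ℂ) (g : G) : star (ρ g).trace = (ρ g⁻¹).trace := by
  classical
  set P : Matrix n n ℂ := ∑ h : G, (ρ h)ᴴ * ρ h with hP
  have hinv : (ρ g)ᴴ * P * ρ g = P := by
    rw [hP, Finset.mul_sum, Finset.sum_mul]
    refine Fintype.sum_equiv (Equiv.mulRight g) _ _ fun h => ?_
    simp [map_mul, Matrix.mul_assoc, conjTranspose_mul]
  have hpd : P.PosDef := by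
    have : P = (∑ h ∈ Finset.univ.erase (1 : G), (ρ h)ᴴ * ρ h) + 1 := by
      rw [hP, ← Finset.sum_erase_add _ _ (Finset.mem_univ (1 : G))]; simp
    rw [this]
    exact Matrix.PosDef.posSemidef_add
      (Matrix.posSemidef_sum _ (fun h _ => Matrix.posSemidef_conjTranspose_mul_self _))
      Matrix.PosDef.one
  have hu : IsUnit P := hpd.isUnit
  have hgg : ρ g * ρ g⁻¹ = 1 := by rw [← map_mul]; simp
  have h2 : (ρ g)ᴴ * P = P * ρ g⁻¹ := by
    calc (ρ g)ᴴ * P = (ρ g)ᴴ * P * (ρ g * ρ g⁻¹) := by rw [hgg, mul_one]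
      _ = ((ρ g)ᴴ * P * ρ g) * ρ g⁻¹ := by simp only [Matrix.mul_assoc]
      _ = _ := by rw [hinv]
  obtain ⟨u, hu⟩ := hu
  have h3 : (ρ g)ᴴ = P * ρ g⁻¹ * (↑u⁻¹ : Matrix n n ℂ) := by
    rw [← h2, Matrix.mul_assoc, ← hu]; simp
  rw [← trace_conjTranspose, h3, trace_mul_comm, ← Matrix.mul_assoc, ← hu]; simp

lemma aux_conj {G : Type} [Group G] [Fintype G] {V : Type} [AddCommGroup V] [Module ℂ V]
    [FiniteDimensional ℂ V] (ρ : Representation ℂ G V) (g : G) :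
    (starRingEnd ℂ) (ρ.character g) = ρ.character g⁻¹ := by
  let b := Module.finBasis ℂ V
  have h := aux_conj_matrix
    ((LinearMap.toMatrixAlgEquiv b).toAlgHom.toRingHom.toMonoidHom.comp ρ) g
  simp only [Representation.character, LinearMap.trace_eq_matrix_trace ℂ b]
  exact h

lemma aux_span {G : Type} [Group G] [Fintype G] (n : ℕ) : ∀ (V : Type) [AddCommGroup V] [Module ℂ V]
    [FiniteDimensional ℂ V] (ρ : Representation ℂ G V), Module.finrank ℂ V = n →
    ρ.character ∈ Submodule.span ℂ {χ | IsIrrChar G χ} := by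
  induction n using Nat.strong_induction_on with
  | _ n ih =>
  intro V _ _ _ ρ hn
  by_cases hV : Nontrivial V
  · by_cases hirr : ∀ W : Submodule ℂ V, (∀ g, ∀ x ∈ W, ρ g x ∈ W) → W = ⊥ ∨ W = ⊤
    · exact Submodule.subset_span ⟨V, _, _, inferInstance, ρ, hV, hirr, fun g => rfl⟩
    · push Not at hirr
      obtain ⟨W, hW, hb, ht⟩ := hirr
      let S : Subrepresentation ρ := ⟨W, fun g x hx => hW g x hx⟩
      haveI : NeZero (Nat.card G : ℂ) := ⟨by simp⟩
      obtain ⟨T, hT⟩ := exists_isCompl S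
      have hc : IsCompl S.toSubmodule T.toSubmodule := by
        constructor
        · rw [disjoint_iff]
          have := disjoint_iff.1 hT.1
          exact congrArg Subrepresentation.toSubmodule this
        · rw [codisjoint_iff]
          have := codisjoint_iff.1 hT.2
          exact congrArg Subrepresentation.toSubmodule this
      have hchar : ρ.character = S.toRepresentation.character + T.toRepresentation.character := by
        ext g
        have hint := (DirectSum.isInternal_submodule_iff_isCompl
          (fun b : Bool => if b then S.toSubmodule else T.toSubmodule) (i := true) (j := false)
          (by simp) (by ext b; cases b <;> simp)).2 (by simpa using hc)
        have := LinearMap.trace_eq_sum_trace_restrict hint (f := ρ g) (by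
          intro b; cases b
          · exact T.apply_mem_toSubmodule g
          · exact S.apply_mem_toSubmodule g)
        rw [Fintype.sum_bool] at this
        exact this
      have hsum := Submodule.finrank_add_eq_of_isCompl hc
      have hS : Module.finrank ℂ S.toSubmodule < n := hn ▸ Submodule.finrank_lt ht
      have hS0 : 0 < Module.finrank ℂ S.toSubmodule := by
        rw [Nat.pos_iff_ne_zero, Ne, Submodule.finrank_eq_zero]; exact hb
      rw [hchar]
      exact Submodule.add_mem _ (ih _ hS _ _ rfl) (ih _ (by omega) _ _ rfl)
  · rw [not_nontrivial_iff_subsingleton] at hV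
    have : ρ.character = 0 := by
      ext g
      have : ρ g = 0 := Subsingleton.elim _ _
      simp [Representation.character, this]
    rw [this]; exact Submodule.zero_mem _

lemma aux_irr {G : Type} [Group G] {V : Type} [AddCommGroup V] [Module ℂ V] [Nontrivial V]
    (ρ : Representation ℂ G V)
    (h : ∀ W : Submodule ℂ V, (∀ g, ∀ x ∈ W, ρ g x ∈ W) → W = ⊥ ∨ W = ⊤) :
    ρ.IsIrreducible := by
  haveI : Nontrivial (Subrepresentation ρ) :=
    ⟨⊥, ⊤, fun hh => bot_ne_top (α := Submodule ℂ V) (congrArg Subrepresentation.toSubmodule hh)⟩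
  refine ⟨fun S => ?_⟩
  rcases h S.toSubmodule (fun g x hx => S.apply_mem_toSubmodule g hx) with h | h
  · exact Or.inl (Subrepresentation.toSubmodule_injective h)
  · exact Or.inr (Subrepresentation.toSubmodule_injective h)

open scoped Classical in
lemma aux_orth {G : Type} [Group G] [Fintype G] (χ ψ : G → ℂ) (hχ : IsIrrChar G χ)
    (hψ : IsIrrChar G ψ) :
    (Fintype.card G : ℂ)⁻¹ * ∑ g : G, χ g * (starRingEnd ℂ) (ψ g) = if χ = ψ then 1 else 0 := by
  obtain ⟨V, _, _, _, ρ, hV, hi, hρ⟩ := hχ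
  obtain ⟨W, _, _, _, σ, hW, hj, hσ⟩ := hψ
  obtain rfl : χ = ρ.character := funext hρ
  obtain rfl : ψ = σ.character := funext hσ
  haveI := aux_irr ρ hi
  haveI := aux_irr σ hj
  letI : Invertible (Nat.card G : ℂ) := invertibleOfNonzero (by simp)
  simp only [aux_conj, Fintype.card_eq_nat_card]
  split_ifs with h
  · rw [h, Representation.char_orthonormal, if_pos ⟨Representation.Equiv.refl σ⟩]
  · rw [Representation.char_orthonormal, if_neg]
    rintro ⟨e⟩
    exact h (Representation.char_iso e).symm

lemma aux_expand {G : Type} [Group G] [Fintype G]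
    (Sf : Finset (G → ℂ)) (hSf : ∀ χ : G → ℂ, χ ∈ Sf ↔ IsIrrChar G χ) (f : G → ℂ)
    (hf : f ∈ Submodule.span ℂ {χ | IsIrrChar G χ}) (x : G) :
    f x = ∑ χ ∈ Sf, ((Fintype.card G : ℂ)⁻¹ * ∑ g : G, f g * (starRingEnd ℂ) (χ g)) * χ x := by
  classical
  induction hf using Submodule.span_induction with
  | mem f hf =>
    rw [Finset.sum_congr rfl (fun χ hχ => by rw [aux_orth f χ hf ((hSf χ).1 hχ)])]
    simp [(hSf f).2 hf]
  | zero => simp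
  | add f g _ _ hf hg =>
    rw [Pi.add_apply, hf, hg, ← Finset.sum_add_distrib]
    refine Finset.sum_congr rfl fun χ _ => ?_
    simp only [Pi.add_apply, add_mul, Finset.sum_add_distrib, mul_add]
  | smul a f _ hf =>
    rw [Pi.smul_apply, hf, Finset.smul_sum]
    refine Finset.sum_congr rfl fun χ _ => ?_
    simp only [Pi.smul_apply, smul_eq_mul, mul_assoc, ← Finset.mul_sum]
    ring

lemma aux_perm {G : Type} [Group G] [Fintype G] (X : Type) [Fintype X] [MulAction G X] :
    (fun g : G => (Nat.card {x : X // g • x = x} : ℂ)) ∈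
      Submodule.span ℂ {χ | IsIrrChar G χ} := by
  classical
  let τ : Representation ℂ G (X →₀ ℂ) :=
    { toFun := fun g => Finsupp.lmapDomain ℂ ℂ (fun x => g • x)
      map_one' := by ext; simp
      map_mul' := fun g h => by ext; simp [mul_smul] }
  have hτ : ∀ (g : G) (x : X) (c : ℂ), τ g (Finsupp.single x c) = Finsupp.single (g • x) c := by
    intro g x c
    change Finsupp.lmapDomain ℂ ℂ (fun x => g • x) _ = _
    simp
  have : (fun g : G => (Nat.card {x : X // g • x = x} : ℂ)) =
      τ.character := by
    ext g
    rw [Representation.character, LinearMap.trace_eq_matrix_trace ℂ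
      (Finsupp.basisSingleOne (R := ℂ) (ι := X)), Matrix.trace]
    simp only [Matrix.diag, LinearMap.toMatrix_apply, Finsupp.coe_basisSingleOne,
      hτ, Finsupp.basisSingleOne_repr, LinearEquiv.refl_apply,
      Finsupp.single_apply]
    simp [Nat.card_eq_fintype_card, Fintype.card_subtype]
  rw [this]
  exact aux_span _ _ _ rfl

/-- With `π = Ind_H^G 1` the permutation character of `G` on `G/H` and
`r+1` the number of orbits of `G` on unordered pairs of cosets,
`r + 1 = (1/2)·Σ_{χ ∈ Irr G} m_χ(m_χ + ν₂(χ))`, where `m_χ = ⟨π,χ⟩` and `ν₂` is the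
Frobenius–Schur indicator. -/
theorem stmt6 {G : Type} [Group G] [Fintype G] (H : Subgroup G)
    (Sf : Finset (G → ℂ)) (hSf : ∀ χ : G → ℂ, χ ∈ Sf ↔ IsIrrChar G χ) :
    -- `r + 1`, the number of orbits of `G` on unordered pairs of cosets:
    ((Nat.card (Quot (fun p q : Sym2 (G ⧸ H) =>
        ∃ g : G, Sym2.map (fun x => g • x) p = q)) : ℂ))
    = (1/2) * ∑ χ ∈ Sf,
        -- `m_χ = ⟨π, χ⟩` with `π` the permutation character:
        ((Fintype.card G : ℂ)⁻¹ *
          ∑ g : G, (Nat.card {x : G ⧸ H // g • x = x} : ℂ) * (starRingEnd ℂ) (χ g)) *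
        (((Fintype.card G : ℂ)⁻¹ *
          ∑ g : G, (Nat.card {x : G ⧸ H // g • x = x} : ℂ) * (starRingEnd ℂ) (χ g))
          -- `+ ν₂(χ)`, the Frobenius–Schur indicator:
          + (Fintype.card G : ℂ)⁻¹ * ∑ g : G, χ (g ^ 2)) := by

  classical
  letI : Fintype (G ⧸ H) := Fintype.ofFinite _
  have hexp := aux_expand Sf hSf _ (aux_perm (G := G) (G ⧸ H))
  rw [aux_burnside (G ⧸ H)]
  congr 1
  set c : ℂ := (Fintype.card G : ℂ)⁻¹ with hc
  set π : G → ℂ := fun g => (Nat.card {x : G ⧸ H // g • x = x} : ℂ) with hπ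
  set m : (G → ℂ) → ℂ := fun χ => c * ∑ g : G, π g * (starRingEnd ℂ) (χ g) with hm
  change c * ∑ g : G, (π g ^ 2 + π (g ^ 2)) =
    ∑ χ ∈ Sf, m χ * (m χ + c * ∑ g : G, χ (g ^ 2))
  have hexp' : ∀ x, π x = ∑ χ ∈ Sf, m χ * χ x := hexp
  have hreal : ∀ x, (starRingEnd ℂ) (π x) = π x := fun x => by simp [hπ]
  -- `m χ` is real: it is an inner product of characters
  have hmr : ∀ χ ∈ Sf, (starRingEnd ℂ) (m χ) = m χ := by
    intro χ hχ
    obtain ⟨V, _, _, _, ρ, hV, hi, hρ⟩ := (hSf χ).1 hχ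
    obtain rfl : χ = ρ.character := funext hρ
    have hinv : ∀ g, π g⁻¹ = π g := by
      intro g
      simp only [hπ]
      congr 1
      refine Nat.card_congr (Equiv.subtypeEquivRight fun x => ?_)
      rw [inv_smul_eq_iff, eq_comm]
    simp only [hm, map_mul, map_sum, hreal, aux_conj]
    have : (starRingEnd ℂ) c = c := by simp [hc]
    rw [this]
    congr 1
    refine Fintype.sum_equiv (Equiv.inv G) _ _ fun g => ?_
    simp [hinv]
  have h1 : c * ∑ g : G, π g ^ 2 = ∑ χ ∈ Sf, m χ * m χ := by
    have : ∀ g, π g ^ 2 = ∑ χ ∈ Sf, m χ * (π g * (starRingEnd ℂ) (χ g)) := by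
      intro g
      rw [sq]
      nth_rewrite 2 [← hreal g]
      rw [hexp' g, map_sum, ← hexp' g, Finset.mul_sum]
      refine Finset.sum_congr rfl fun χ hχ => ?_
      rw [map_mul, hmr χ hχ]; ring
    rw [Finset.sum_congr rfl (fun g _ => this g), Finset.sum_comm, Finset.mul_sum]
    refine Finset.sum_congr rfl fun χ hχ => ?_
    rw [← Finset.mul_sum]; simp only [hm]; ring
  have h2 : c * ∑ g : G, π (g ^ 2) = ∑ χ ∈ Sf, m χ * (c * ∑ g : G, χ (g ^ 2)) := by
    rw [Finset.sum_congr rfl (fun g _ => hexp' (g ^ 2)), Finset.sum_comm, Finset.mul_sum]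
    refine Finset.sum_congr rfl fun χ hχ => ?_
    rw [← Finset.mul_sum]; ring
  rw [Finset.sum_add_distrib, mul_add, h1, h2, ← Finset.sum_add_distrib]
  exact Finset.sum_congr rfl fun χ _ => by ring
end

section
/- In PSL(2,19), let s₀, s₁, s₂ be the images of S₀ = [[0,1],[-1,0]], S₁ = [[0,2],[9,0]], S₂ = [[8,-7],[-7,-8]] ∈ SL(2,19). Then s₀, s₁, s₂ are involutions generating PSL(2,19), s₀s₂ = s₂s₀, the product s₁s₂ has order 3, and the subgroup H = ⟨s₁,s₂⟩ is isomorphic to the symmetric group S₃ of order 6. -/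
open Matrix

namespace Stmt8Aux

abbrev G := SpecialLinearGroup (Fin 2) (ZMod 19)

abbrev P := ProjectiveSpecialLinearGroup (Fin 2) (ZMod 19)

def A0 : G := ⟨!![0, 1; -1, 0], by decide⟩

def A1 : G := ⟨!![0, 2; 9, 0], by decide⟩

def A2 : G := ⟨!![8, -7; -7, -8], by decide⟩

def U (x : ZMod 19) : G := ⟨!![1, x; 0, 1], by simp⟩

def L (x : ZMod 19) : G := ⟨!![1, 0; x, 1], by simp⟩

lemma val_mul (A B : G) : (A * B).1 = A.1 * B.1 := rfl

lemma U_val (x : ZMod 19) : (U x).1 = !![1, x; 0, 1] := rfl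

lemma L_val (x : ZMod 19) : (L x).1 = !![1, 0; x, 1] := rfl

lemma A0_val : A0.1 = !![0, 1; -1, 0] := rfl

lemma mk_one {A : G} (h : ∃ r : ZMod 19, r ^ 2 = 1 ∧ A.1 = !![r, 0; 0, r]) :
    (QuotientGroup.mk A : P) = 1 := by
  rw [QuotientGroup.eq_one_iff, Matrix.SpecialLinearGroup.mem_center_iff]
  obtain ⟨r, hr, h⟩ := h
  refine ⟨r, by simpa using hr, ?_⟩
  rw [h]
  ext i j
  fin_cases i <;> fin_cases j <;> simp

lemma offdiag {A : G} (h : (QuotientGroup.mk A : P) = 1) : A.1 0 1 = 0 ∧ A.1 1 0 = 0 := by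
  rw [QuotientGroup.eq_one_iff, Matrix.SpecialLinearGroup.mem_center_iff] at h
  obtain ⟨r, hr, h⟩ := h
  rw [← h]
  simp

lemma mk_eq {A B : G} (h : A = B ∨ A.1 = - B.1) :
    (QuotientGroup.mk A : P) = QuotientGroup.mk B := by
  rcases h with h | h
  · rw [h]
  · have h2 : A = -B := Subtype.ext h
    rw [h2]
    have h3 : (-B : G) = (-1 : G) * B := by simp
    have h4 : (QuotientGroup.mk (-1 : G) : P) = 1 := by
      apply mk_one
      exact ⟨-1, by norm_num, by decide⟩
    rw [h3, QuotientGroup.mk_mul, h4, one_mul]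

lemma U_add (x y : ZMod 19) : U x * U y = U (x + y) := by
  apply Subtype.ext
  rw [val_mul, U_val, U_val, U_val]
  simp [add_comm]

lemma U_pow (x : ZMod 19) (n : ℕ) : U x ^ n = U (n * x) := by
  induction n with
  | zero => rw [pow_zero, Nat.cast_zero, zero_mul]; decide
  | succ n ih => rw [pow_succ, ih, U_add]; congr 1; push_cast; ring

lemma U5 : A2 * A1 * A0 * A1 * A0 * A1 * A0 * A1 * A2 * A1 * A0 * A1 * A0 * A1 * A0 * A2 * A1 = U 5 := by decide

lemma S_gen : Subgroup.closure {A0, A1, A2} = (⊤ : Subgroup G) := by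
  set K := Subgroup.closure {A0, A1, A2} with hK
  have h0 : A0 ∈ K := Subgroup.subset_closure (by simp)
  have h1 : A1 ∈ K := Subgroup.subset_closure (by simp)
  have h2 : A2 ∈ K := Subgroup.subset_closure (by simp)
  have h5 : U 5 ∈ K := by
    rw [← U5]
    repeat' apply K.mul_mem
    all_goals assumption
  have hU : ∀ x, U x ∈ K := by
    intro x
    have := K.pow_mem h5 (4 * x).val
    rw [U_pow] at this
    convert this using 2
    rw [ZMod.natCast_zmod_val]
    have h20 : (4 * 5 : ZMod 19) = 1 := by decide
    linear_combination (-x) * h20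
  have hL : ∀ x, L x ∈ K := by
    intro x
    have : L x = A0⁻¹ * U (-x) * A0 := by
      rw [mul_assoc, eq_inv_mul_iff_mul_eq]
      apply Subtype.ext
      rw [val_mul, val_mul, L_val, U_val, A0_val]
      simp
    rw [this]
    exact K.mul_mem (K.mul_mem (K.inv_mem h0) (hU _)) h0
  have key : ∀ A : G, A.1 1 0 ≠ 0 → A ∈ K := by
    intro A hc
    have : Fact (Nat.Prime 19) := ⟨by norm_num⟩
    have hdet : A.1 0 0 * A.1 1 1 - A.1 0 1 * A.1 1 0 = 1 := by
      rw [← Matrix.det_fin_two]; exact A.2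
    have : A = U ((A.1 0 0 - 1) / A.1 1 0) * L (A.1 1 0) * U ((A.1 1 1 - 1) / A.1 1 0) := by
      apply Subtype.ext
      rw [val_mul, val_mul, U_val, U_val, L_val]
      ext i j
      fin_cases i <;> fin_cases j <;> simp <;> field_simp <;> try ring1
      linear_combination -hdet
    rw [this]
    exact K.mul_mem (K.mul_mem (hU _) (hL _)) (hU _)
  rw [eq_top_iff]
  intro A _
  by_cases hc : A.1 1 0 = 0
  · have h : A0 * A ∈ K := by
      apply key
      have hdet : A.1 0 0 * A.1 1 1 - A.1 0 1 * A.1 1 0 = 1 := by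
        rw [← Matrix.det_fin_two]; exact A.2
      intro h
      have h' : A.1 0 0 = 0 := by
        rw [val_mul, A0_val] at h
        simpa [Matrix.mul_apply, Fin.sum_univ_two] using h
      rw [hc, h'] at hdet
      exact absurd hdet (by simp; decide)
    exact (K.mul_mem_cancel_left h0).1 h
  · exact key A hc

def c01 : Equiv.Perm (Fin 3) := Equiv.swap 0 1

def c12 : Equiv.Perm (Fin 3) := Equiv.swap 1 2

def g (σ : Equiv.Perm (Fin 3)) : G :=
  if σ = 1 then 1 else if σ = c01 then A1 else if σ = c12 then A2
  else if σ = c01 * c12 then A1 * A2 else if σ = c12 * c01 then A2 * A1 else A1 * A2 * A1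

lemma g_mul : ∀ σ τ, g (σ * τ) = g σ * g τ ∨ (g (σ * τ)).1 = -(g σ * g τ).1 := by decide

lemma g_off : ∀ σ, (g σ).1 0 1 = 0 → σ = 1 := by decide

def f : Equiv.Perm (Fin 3) →* P where
  toFun σ := QuotientGroup.mk (g σ)
  map_one' := rfl
  map_mul' σ τ := by rw [← QuotientGroup.mk_mul]; exact mk_eq (g_mul σ τ)

lemma f_inj : Function.Injective f := by
  rw [injective_iff_map_eq_one]
  intro σ h
  exact g_off σ (offdiag h).1

lemma perm_cases : ∀ σ : Equiv.Perm (Fin 3), σ = 1 ∨ σ = c01 ∨ σ = c12 ∨ σ = c01 * c12 ∨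
    σ = c12 * c01 ∨ σ = c01 * c12 * c01 := by decide

lemma perm_gen : Subgroup.closure {c01, c12} = (⊤ : Subgroup (Equiv.Perm (Fin 3))) := by
  rw [eq_top_iff]
  intro σ _
  have h1 : c01 ∈ Subgroup.closure {c01, c12} := Subgroup.subset_closure (by simp)
  have h2 : c12 ∈ Subgroup.closure {c01, c12} := Subgroup.subset_closure (by simp)
  rcases perm_cases σ with h | h | h | h | h | h <;> rw [h]
  · exact one_mem _
  · exact h1
  · exact h2
  · exact mul_mem h1 h2
  · exact mul_mem h2 h1
  · exact mul_mem (mul_mem h1 h2) h1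

lemma f_range : f.range = Subgroup.closure {(QuotientGroup.mk A1 : P), QuotientGroup.mk A2} := by
  rw [MonoidHom.range_eq_map, ← perm_gen, MonoidHom.map_closure, Set.image_pair]
  congr 1

end Stmt8Aux

open Stmt8Aux in
/-- (Example `expl:pslconcrete`.) In `PSL(2,19)`, the images `s₀,s₁,s₂`
of `S₀ = [[0,1],[-1,0]]`, `S₁ = [[0,2],[9,0]]`, `S₂ = [[8,-7],[-7,-8]] ∈ SL(2,19)`
are involutions generating `PSL(2,19)`, with `s₀s₂ = s₂s₀`, `s₁s₂` of order 3, and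
`H = ⟨s₁,s₂⟩ ≅ S₃` of order 6. -/
theorem stmt8
    (S₀ S₁ S₂ : SpecialLinearGroup (Fin 2) (ZMod 19))
    (hS₀ : (S₀ : Matrix (Fin 2) (Fin 2) (ZMod 19)) = !![0, 1; -1, 0])
    (hS₁ : (S₁ : Matrix (Fin 2) (Fin 2) (ZMod 19)) = !![0, 2; 9, 0])
    (hS₂ : (S₂ : Matrix (Fin 2) (Fin 2) (ZMod 19)) = !![8, -7; -7, -8])
    (s₀ s₁ s₂ : ProjectiveSpecialLinearGroup (Fin 2) (ZMod 19))
    (hs₀ : s₀ = QuotientGroup.mk S₀)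
    (hs₁ : s₁ = QuotientGroup.mk S₁)
    (hs₂ : s₂ = QuotientGroup.mk S₂) :
    (s₀ ≠ 1 ∧ s₀ ^ 2 = 1) ∧ (s₁ ≠ 1 ∧ s₁ ^ 2 = 1) ∧ (s₂ ≠ 1 ∧ s₂ ^ 2 = 1) ∧
    Subgroup.closure {s₀, s₁, s₂} = ⊤ ∧
    s₀ * s₂ = s₂ * s₀ ∧
    orderOf (s₁ * s₂) = 3 ∧
    Nat.card (Subgroup.closure {s₁, s₂}) = 6 ∧
    Nonempty ((Subgroup.closure {s₁, s₂}) ≃* Equiv.Perm (Fin 3)) := by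
  obtain rfl : S₀ = A0 := Subtype.ext hS₀
  obtain rfl : S₁ = A1 := Subtype.ext hS₁
  obtain rfl : S₂ = A2 := Subtype.ext hS₂
  subst hs₀ hs₁ hs₂
  have e : Equiv.Perm (Fin 3) ≃* Subgroup.closure {(QuotientGroup.mk A1 : P), QuotientGroup.mk A2} :=
    (MonoidHom.ofInjective f_inj).trans (MulEquiv.subgroupCongr f_range)
  refine ⟨⟨?_, ?_⟩, ⟨?_, ?_⟩, ⟨?_, ?_⟩, ?_, ?_, ?_, ?_, ⟨e.symm⟩⟩
  · intro h; exact absurd (offdiag h).1 (by decide)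
  · rw [← QuotientGroup.mk_pow]; exact mk_one ⟨-1, by decide, by decide⟩
  · intro h; exact absurd (offdiag h).1 (by decide)
  · rw [← QuotientGroup.mk_pow]; exact mk_one ⟨-1, by decide, by decide⟩
  · intro h; exact absurd (offdiag h).1 (by decide)
  · rw [← QuotientGroup.mk_pow]; exact mk_one ⟨-1, by decide, by decide⟩
  · have h := congrArg (Subgroup.map (QuotientGroup.mk' (Subgroup.center G))) S_gen
    rw [MonoidHom.map_closure, Subgroup.map_top_of_surjective _ (QuotientGroup.mk'_surjective _)] at h
    simpa [Set.image_insert_eq] using h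
  · rw [← QuotientGroup.mk_mul, ← QuotientGroup.mk_mul]
    exact mk_eq (Or.inr (by decide))
  · have : Fact (Nat.Prime 3) := ⟨by norm_num⟩
    apply orderOf_eq_prime
    · rw [← QuotientGroup.mk_mul, ← QuotientGroup.mk_pow]
      exact mk_one ⟨1, by decide, by decide⟩
    · rw [← QuotientGroup.mk_mul]
      intro h; exact absurd (offdiag h).1 (by decide)
  · rw [← Nat.card_congr e.toEquiv, Nat.card_eq_fintype_card]
    decide
end

section
/- Let p be a prime with p ≡ -1 (mod 4). Then there exists an irreducible complex character χ of PSL(2,p) with χ(1) = (p-1)/2 such that χ(g) ∉ ℝ whenever g has order p, and χ(g) ∈ {-1, 0, 1} for all other nonidentity g. In particular χ ≠ χ̄. -/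
open Matrix

namespace WeilAux

open Finset

/-- The complex valued quadratic character. -/
noncomputable def eps (p : ℕ) [Fact p.Prime] : MulChar (ZMod p) ℂ :=
  (quadraticChar (ZMod p)).ringHomComp (Int.castRingHom ℂ)

/-- The additive character. -/
noncomputable def psi (p : ℕ) [Fact p.Prime] : AddChar (ZMod p) ℂ := ZMod.stdAddChar

/-- The quadratic Gauss sum. -/
noncomputable def G (p : ℕ) [Fact p.Prime] : ℂ := gaussSum (eps p) (psi p)

section
variable {p : ℕ} [Fact p.Prime]

lemma ringChar_ne (hp : p % 4 = 3) : ringChar (ZMod p) ≠ 2 := by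
  rw [ZMod.ringChar_zmod_n]; omega

lemma psi_prim : (psi p).IsPrimitive := ZMod.isPrimitive_stdAddChar p

lemma eps_dich {a : ZMod p} (ha : a ≠ 0) : eps p a = 1 ∨ eps p a = -1 := by
  rcases quadraticChar_dichotomy ha with h | h <;> simp [eps, MulChar.ringHomComp_apply, h]

lemma eps_mul_self {a : ZMod p} (ha : a ≠ 0) : eps p a * eps p a = 1 := by
  rcases eps_dich ha with h | h <;> simp [h]

lemma eps_inv (a : ZMod p) : eps p a⁻¹ = eps p a := by
  by_cases ha : a = 0
  · simp [ha]
  · have h1 : eps p a * eps p a⁻¹ = 1 := by rw [← map_mul, mul_inv_cancel₀ ha, map_one]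
    rcases eps_dich ha with h | h
    · rw [h] at h1 ⊢; linear_combination h1
    · rw [h] at h1 ⊢; linear_combination -h1

lemma eps_neg_one (hp : p % 4 = 3) : eps p (-1) = -1 := by
  have h : ¬ IsSquare (-1 : ZMod p) := by
    rw [ZMod.exists_sq_eq_neg_one_iff]; simpa using hp
  have := quadraticChar_neg_one_iff_not_isSquare.2 h
  simp [eps, MulChar.ringHomComp_apply, this]

lemma eps_ne_one (hp : p % 4 = 3) : eps p ≠ 1 := by
  intro h
  have h1 := eps_neg_one hp
  have h2 : eps p (-1) = 1 := by
    rw [h]; exact MulChar.one_apply (isUnit_one.neg)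
  rw [h2] at h1
  norm_num at h1

lemma eps_quad : (eps p).IsQuadratic := by
  intro a
  by_cases ha : a = 0
  · left; rw [ha]; exact MulChar.map_zero _
  · right; exact eps_dich ha

lemma G_sq (hp : p % 4 = 3) : G p ^ 2 = -(p : ℂ) := by
  have h := gaussSum_sq (χ := eps p) (eps_ne_one hp) eps_quad (psi_prim (p := p))
  rw [eps_neg_one hp, ZMod.card] at h
  rw [G, h]; ring

lemma p_ne : (p : ℂ) ≠ 0 := by exact_mod_cast (Fact.out : p.Prime).ne_zero

lemma G_ne (hp : p % 4 = 3) : G p ≠ 0 := by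
  intro h
  have := G_sq hp
  rw [h] at this
  have h2 := p_ne (p := p)
  apply h2
  linear_combination (-1 : ℂ) * (this.symm)

lemma G_inv (hp : p % 4 = 3) : (G p)⁻¹ * p = - G p := by
  have h := G_ne hp
  field_simp
  linear_combination (-1 : ℂ) * (G_sq hp).symm

lemma sum_lin (b : ZMod p) : ∑ x, psi p (x * b) = if b = 0 then (p : ℂ) else 0 := by
  rw [AddChar.sum_mulShift b psi_prim, ZMod.card]
  push_cast; rfl

lemma sum_quad (hp : p % 4 = 3) {a : ZMod p} (ha : a ≠ 0) :
    ∑ y, psi p (a * y ^ 2) = eps p a * G p := by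
  have h1 : ∑ y, psi p (a * y ^ 2) = ∑ t, (eps p t + 1) * psi p (a * t) := by
    rw [← Finset.sum_fiberwise (s := univ) (g := fun y : ZMod p => y ^ 2)]
    refine Finset.sum_congr rfl fun t _ => ?_
    have h := quadraticChar_card_sqrts (ringChar_ne hp) t
    have h' : ((#{y : ZMod p | y ^ 2 = t} : ℕ) : ℂ) = eps p t + 1 := by
      have h2 : (((#{x : ZMod p | x ^ 2 = t}.toFinset : ℕ) : ℤ) : ℂ)
          = eps p t + 1 := by rw [h]; simp [eps, MulChar.ringHomComp_apply]
      rw [← h2]; push_cast; congr 2; ext; simp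
    rw [← h', ← nsmul_eq_mul, ← Finset.sum_const]
    refine Finset.sum_congr rfl fun y hy => ?_
    simp only [mem_filter, mem_univ, true_and] at hy
    rw [hy]
  have h2 : ∑ t, psi p (a * t) = 0 := by
    have := sum_lin (p := p) a
    simp only [ha, if_false] at this
    rw [← this]
    simp_rw [mul_comm a]
  have h3 := gaussSum_mulShift (eps p) (psi p) (Units.mk0 a ha)
  rw [h1]
  simp_rw [add_mul, one_mul, Finset.sum_add_distrib, h2, add_zero]
  have h4 : ∑ t, eps p t * psi p (a * t) = gaussSum (eps p) ((psi p).mulShift (Units.mk0 a ha)) := by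
    simp [gaussSum, AddChar.mulShift_apply]
  rw [h4, G, ← h3, Units.val_mk0, ← mul_assoc, eps_mul_self ha, one_mul]

lemma sum_quad_lin (hp : p % 4 = 3) {a : ZMod p} (ha : a ≠ 0) (b c : ZMod p) :
    ∑ y, psi p (a * y ^ 2 - 2 * b * y + c) = eps p a * G p * psi p (c - b ^ 2 / a) := by
  rw [← sum_quad hp ha, Finset.sum_mul]
  refine Fintype.sum_equiv (Equiv.subRight (b / a)) _ _ fun y => ?_
  rw [← AddChar.map_add_eq_mul]
  congr 1
  simp only [Equiv.subRight_apply]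
  field_simp
  ring

variable (p) in
/-- The kernel of the Weil representation. -/
noncomputable def k (a b c d x y : ZMod p) : ℂ :=
  if c = 0 then (if y = a * x then eps p a * psi p (a * b * x ^ 2) else 0)
  else (G p)⁻¹ * eps p c * psi p ((a * x ^ 2 - 2 * x * y + d * y ^ 2) / c)

lemma two_ne (hp : p % 4 = 3) : (2 : ZMod p) ≠ 0 := by
  have := Ring.two_ne_zero (R := ZMod p) (ringChar_ne hp)
  exact this

lemma k_mul (hp : p % 4 = 3) {a1 b1 c1 d1 a2 b2 c2 d2 : ZMod p} (h1 : a1 * d1 - b1 * c1 = 1)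
    (h2 : a2 * d2 - b2 * c2 = 1) (x z : ZMod p) :
    ∑ y, k p a1 b1 c1 d1 x y * k p a2 b2 c2 d2 y z =
      k p (a1 * a2 + b1 * c2) (a1 * b2 + b1 * d2) (c1 * a2 + d1 * c2) (c1 * b2 + d1 * d2) x z := by
  by_cases hc1 : c1 = 0
  · subst hc1
    have hd1 : d1 ≠ 0 := by rintro rfl; simp at h1
    have ha1 : a1 ≠ 0 := by rintro rfl; simp at h1
    have hd : d1 = a1⁻¹ := by field_simp; linear_combination h1
    have hL : ∑ y, k p a1 b1 0 d1 x y * k p a2 b2 c2 d2 y z =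
        eps p a1 * psi p (a1 * b1 * x ^ 2) * k p a2 b2 c2 d2 (a1 * x) z := by
      rw [Finset.sum_eq_single (a1 * x)]
      · simp [k]
      · intro y _ hy
        simp [k, hy]
      · simp
    rw [hL]
    by_cases hc2 : c2 = 0
    · subst hc2
      simp only [k, mul_zero, zero_mul, add_zero, if_true]
      have e : a2 * (a1 * x) = a1 * a2 * x := by ring
      rw [e]
      split_ifs
      · rw [map_mul (eps p)]
        have : psi p (a1 * a2 * (a1 * b2 + b1 * d2) * x ^ 2)
            = psi p (a1 * b1 * x ^ 2) * psi p (a2 * b2 * (a1 * x) ^ 2) := by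
          rw [← AddChar.map_add_eq_mul]; congr 1
          linear_combination (a1 * b1 * x^2) * h2
        rw [this]; ring
      · simp
    · have hc3 : 0 * a2 + d1 * c2 ≠ 0 := by simp [hd1, hc2]
      simp only [k, hc2, hc3, if_false]
      have e1 : eps p (0 * a2 + d1 * c2) = eps p a1 * eps p c2 := by
        rw [zero_mul, zero_add, map_mul, hd, eps_inv]
      have e2 : psi p (((a1 * a2 + b1 * c2) * x ^ 2 - 2 * x * z + (0 * b2 + d1 * d2) * z ^ 2) /
          (0 * a2 + d1 * c2)) = psi p (a1 * b1 * x ^ 2) *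
            psi p ((a2 * (a1 * x) ^ 2 - 2 * (a1 * x) * z + d2 * z ^ 2) / c2) := by
        rw [← AddChar.map_add_eq_mul]; congr 1
        rw [hd]; simp only [zero_mul, zero_add]; field_simp; ring
      rw [e1, e2]; ring
  · by_cases hc2 : c2 = 0
    · subst hc2
      have hd2 : d2 ≠ 0 := by rintro rfl; simp at h2
      have ha2 : a2 ≠ 0 := by rintro rfl; simp at h2
      have hd : d2 = a2⁻¹ := by field_simp; linear_combination h2
      have hL : ∑ y, k p a1 b1 c1 d1 x y * k p a2 b2 0 d2 y z =
          k p a1 b1 c1 d1 x (d2 * z) * (eps p a2 * psi p (a2 * b2 * (d2 * z) ^ 2)) := by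
        have : ∀ y, z = a2 * y ↔ y = d2 * z := by
          intro y; rw [hd]; constructor
          · rintro rfl; field_simp
          · rintro rfl; field_simp
        simp [k, this]
      rw [hL]
      have hc3 : c1 * a2 + d1 * 0 ≠ 0 := by simp [hc1, ha2]
      simp only [k, hc1, hc3, if_false]
      have e1 : eps p (c1 * a2 + d1 * 0) = eps p c1 * eps p a2 := by
        rw [mul_zero, add_zero, map_mul]
      have e2 : psi p (((a1 * a2 + b1 * 0) * x ^ 2 - 2 * x * z + (c1 * b2 + d1 * d2) * z ^ 2) /
          (c1 * a2 + d1 * 0)) = psi p ((a1 * x ^ 2 - 2 * x * (d2 * z) + d1 * (d2 * z) ^ 2) / c1) *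
            psi p (a2 * b2 * (d2 * z) ^ 2) := by
        rw [← AddChar.map_add_eq_mul]; congr 1
        rw [hd]; field_simp; ring
      rw [e1, e2]; ring
    · have hL : ∑ y, k p a1 b1 c1 d1 x y * k p a2 b2 c2 d2 y z =
          (G p)⁻¹ * (G p)⁻¹ * (eps p c1 * eps p c2) *
          ∑ y, psi p ((c1 * a2 + d1 * c2) / (c1 * c2) * y ^ 2 - 2 * (x / c1 + z / c2) * y +
            (a1 * x ^ 2 / c1 + d2 * z ^ 2 / c2)) := by
        rw [Finset.mul_sum]
        refine Finset.sum_congr rfl fun y _ => ?_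
        simp only [k, hc1, hc2, if_false]
        have : (c1 * a2 + d1 * c2) / (c1 * c2) * y ^ 2 - 2 * (x / c1 + z / c2) * y +
            (a1 * x ^ 2 / c1 + d2 * z ^ 2 / c2) = (a1 * x ^ 2 - 2 * x * y + d1 * y ^ 2) / c1 +
            (a2 * y ^ 2 - 2 * y * z + d2 * z ^ 2) / c2 := by
          field_simp; ring
        rw [this, AddChar.map_add_eq_mul]; ring
      rw [hL]
      have hG := G_ne hp
      by_cases hc3 : c1 * a2 + d1 * c2 = 0
      · simp only [k, hc3, if_true, zero_div, zero_mul, zero_sub]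
        have ha3 : a1 * a2 + b1 * c2 = - c2 / c1 := by
          field_simp; linear_combination a1 * hc3 - c2 * h1
        have hsum : ∑ y, psi p (-(2 * (x / c1 + z / c2) * y) +
            (a1 * x ^ 2 / c1 + d2 * z ^ 2 / c2)) =
            (if z = (a1 * a2 + b1 * c2) * x then (p : ℂ) else 0) *
              psi p (a1 * x ^ 2 / c1 + d2 * z ^ 2 / c2) := by
          have := sum_lin (p := p) (-(2 * (x / c1 + z / c2)))
          have hz : -(2 * (x / c1 + z / c2)) = 0 ↔ z = (a1 * a2 + b1 * c2) * x := by
            rw [ha3, neg_eq_zero, mul_eq_zero, or_iff_right (two_ne hp)]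
            constructor
            · intro h; field_simp at h ⊢; linear_combination h
            · rintro rfl; field_simp; ring
          simp only [hz] at this
          rw [← this, Finset.sum_mul]
          refine Finset.sum_congr rfl fun y _ => ?_
          rw [← AddChar.map_add_eq_mul]; congr 1; ring
        rw [hsum]
        split_ifs with hz
        · have e1 : eps p (a1 * a2 + b1 * c2) = - (eps p c1 * eps p c2) := by
            rw [ha3, div_eq_mul_inv, map_mul, eps_inv, ← neg_one_mul, map_mul, eps_neg_one hp]; ring
          have e2 : (a1 * a2 + b1 * c2) * (a1 * b2 + b1 * d2) * x ^ 2 =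
              a1 * x ^ 2 / c1 + d2 * z ^ 2 / c2 := by
            have hb : c1 * (a1 * b2 + b1 * d2) = a1 * (c1 * b2 + d1 * d2) - d2 := by
              linear_combination -d2 * h1
            have had : (a1 * a2 + b1 * c2) * (c1 * b2 + d1 * d2) = 1 := by
              linear_combination (a1 * b2 + b1 * d2) * hc3 + (a2 * d2 - b2 * c2) * h1 + h2
            rw [hz]
            have hca : (a1 * a2 + b1 * c2) * c1 = - c2 := by rw [ha3]; field_simp
            field_simp
            linear_combination x ^ 2 * (c2 * (a1 * a2 + b1 * c2)) * hb + x ^ 2 * c2 * a1 * had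
              - x ^ 2 * d2 * (a1 * a2 + b1 * c2) * hca
          rw [e1, e2]
          have := G_inv hp
          have h3 : (G p)⁻¹ * (G p)⁻¹ * p = -1 := by
            rw [mul_assoc, this]; field_simp
          linear_combination (eps p c1 * eps p c2 * psi p (a1 * x ^ 2 / c1 + d2 * z ^ 2 / c2)) * h3
        · simp
      · have hA : (c1 * a2 + d1 * c2) / (c1 * c2) ≠ 0 := by
          simp [hc1, hc2, hc3]
        rw [sum_quad_lin hp hA]
        simp only [k, hc3, if_false]
        have e1 : eps p ((c1 * a2 + d1 * c2) / (c1 * c2)) =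
            eps p (c1 * a2 + d1 * c2) * (eps p c1 * eps p c2) := by
          rw [div_eq_mul_inv, map_mul, eps_inv, map_mul]
        have e2 : a1 * x ^ 2 / c1 + d2 * z ^ 2 / c2 -
            (x / c1 + z / c2) ^ 2 / ((c1 * a2 + d1 * c2) / (c1 * c2)) =
            ((a1 * a2 + b1 * c2) * x ^ 2 - 2 * x * z + (c1 * b2 + d1 * d2) * z ^ 2) /
              (c1 * a2 + d1 * c2) := by
          generalize hc : c1 * a2 + d1 * c2 = c3 at *
          have ex : a1 * c3 - c2 = c1 * (a1 * a2 + b1 * c2) := by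
            linear_combination -a1 * hc + c2 * h1
          have ez : d2 * c3 - c1 = c2 * (c1 * b2 + d1 * d2) := by
            linear_combination -d2 * hc + c1 * h2
          field_simp
          linear_combination (x ^ 2 * c2) * ex + (z ^ 2 * c1) * ez
        rw [e1, e2]
        have h3 := eps_mul_self hc1
        have h4 := eps_mul_self hc2
        have h5 : (eps p c1 * eps p c2) * (eps p c1 * eps p c2) = 1 := by
          linear_combination (eps p c2 * eps p c2) * h3 + h4
        have h6 : (G p)⁻¹ * G p = 1 := inv_mul_cancel₀ hG
        generalize psi p _ = P
        generalize eps p (c1 * a2 + d1 * c2) = Q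
        linear_combination ((G p)⁻¹ * (G p)⁻¹ * Q * G p * P) * h5 + (G p)⁻¹ * Q * P * h6

lemma k_neg_neg (a b c d x y : ZMod p) : k p a b c d (-x) (-y) = k p a b c d x y := by
  simp only [k, mul_neg, neg_inj, neg_mul, neg_neg, even_two, Even.neg_pow]

variable (p) in
/-- The Weil operator as a matrix. -/
noncomputable def K (g : SpecialLinearGroup (Fin 2) (ZMod p)) : Matrix (ZMod p) (ZMod p) ℂ :=
  Matrix.of fun x y => k p (g 0 0) (g 0 1) (g 1 0) (g 1 1) x y

lemma det_eq (g : SpecialLinearGroup (Fin 2) (ZMod p)) :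
    g 0 0 * g 1 1 - g 0 1 * g 1 0 = 1 := by
  have := g.2
  rwa [Matrix.det_fin_two] at this

lemma K_mul (hp : p % 4 = 3) (g h : SpecialLinearGroup (Fin 2) (ZMod p)) :
    K p (g * h) = K p g * K p h := by
  ext x z
  rw [Matrix.mul_apply]
  simp only [K, Matrix.of_apply]
  rw [k_mul hp (det_eq g) (det_eq h)]
  simp [Matrix.mul_apply, Fin.sum_univ_two]

lemma K_apply_of_c (g : SpecialLinearGroup (Fin 2) (ZMod p)) (hc : g 1 0 = 0) (f : ZMod p → ℂ)
    (x : ZMod p) : (K p g *ᵥ f) x =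
      eps p (g 0 0) * psi p (g 0 0 * g 0 1 * x ^ 2) * f (g 0 0 * x) := by
  simp [K, Matrix.mulVec, dotProduct, k, hc]

lemma K_one : K p 1 = 1 := by
  ext x y
  simp [K, k, Matrix.one_apply, eq_comm]

variable (p) in
/-- Odd functions. -/
def Vodd : Submodule ℂ (ZMod p → ℂ) where
  carrier := {f | ∀ x, f (-x) = - f x}
  add_mem' := by
    intro f g hf hg x
    simp only [Set.mem_ofPred_eq] at hf hg
    simp [hf, hg]; ring
  zero_mem' := by intro x; simp
  smul_mem' := by
    intro c f hf x
    simp only [Set.mem_ofPred_eq] at hf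
    simp [hf]

lemma mem_Vodd {f : ZMod p → ℂ} : f ∈ Vodd p ↔ ∀ x, f (-x) = - f x := Iff.rfl

lemma K_mem (g : SpecialLinearGroup (Fin 2) (ZMod p)) :
    ∀ f ∈ Vodd p, Matrix.toLin' (K p g) f ∈ Vodd p := by
  intro f hf x
  rw [mem_Vodd] at hf
  simp only [Matrix.toLin'_apply, Matrix.mulVec, dotProduct, K, Matrix.of_apply]
  rw [← Finset.sum_neg_distrib]
  refine Fintype.sum_equiv (Equiv.neg _) _ _ fun y => ?_
  simp only [Equiv.neg_apply]
  rw [hf, ← k_neg_neg, neg_neg]; ring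

/-- The odd part of the Weil representation of `SL(2,p)`. -/
noncomputable def rho (hp : p % 4 = 3) :
    SpecialLinearGroup (Fin 2) (ZMod p) →* Module.End ℂ (Vodd p) where
  toFun g := (Matrix.toLin' (K p g)).restrict (K_mem g)
  map_one' := by
    ext f x
    simp [K_one]
  map_mul' g h := by
    ext f x
    simp [K_mul hp]

lemma rho_apply (hp : p % 4 = 3) (g : SpecialLinearGroup (Fin 2) (ZMod p)) (f : Vodd p) :
    ((rho hp g f : Vodd p) : ZMod p → ℂ) = K p g *ᵥ f.1 := rfl

lemma center_cases {g : SpecialLinearGroup (Fin 2) (ZMod p)}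
    (hg : g ∈ Subgroup.center (SpecialLinearGroup (Fin 2) (ZMod p))) : g = 1 ∨ g = -1 := by
  obtain ⟨r, hr, h⟩ := Matrix.SpecialLinearGroup.mem_center_iff.1 hg
  rw [Fintype.card_fin, sq, mul_self_eq_one_iff] at hr
  rcases hr with rfl | rfl
  · left
    apply Subtype.ext
    rw [← h]; simp
  · right
    apply Subtype.ext
    rw [← h]; ext i j; fin_cases i <;> fin_cases j <;> simp

lemma center_le (hp : p % 4 = 3) :
    Subgroup.center (SpecialLinearGroup (Fin 2) (ZMod p)) ≤ (rho hp).ker := by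
  intro g hg
  rw [MonoidHom.mem_ker]
  rcases center_cases hg with rfl | rfl
  · exact map_one _
  · ext f x
    rw [rho_apply, K_apply_of_c _ (by simp)]
    have := f.2 x
    simp [eps_neg_one hp, this]

/-- The representation of `PSL(2,p)`. -/
noncomputable def tau (hp : p % 4 = 3) :
    Representation ℂ (ProjectiveSpecialLinearGroup (Fin 2) (ZMod p)) (Vodd p) :=
  QuotientGroup.lift _ (rho hp) (center_le hp)

lemma tau_mk (hp : p % 4 = 3) (g : SpecialLinearGroup (Fin 2) (ZMod p)) :
    tau hp (QuotientGroup.mk g) = rho hp g := rfl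

/-- Projection to odd functions. -/
noncomputable def q : (ZMod p → ℂ) →ₗ[ℂ] Vodd p where
  toFun f := ⟨fun x => (f x - f (-x)) / 2, by intro x; simp; ring⟩
  map_add' f g := by ext x; simp; ring
  map_smul' c f := by ext x; simp; ring

lemma trace_rho (hp : p % 4 = 3) (g : SpecialLinearGroup (Fin 2) (ZMod p)) :
    LinearMap.trace ℂ _ (rho hp g) = (∑ x, K p g x x - ∑ x, K p g x (-x)) / 2 := by
  have h1 : rho hp g = q ∘ₗ (Matrix.toLin' (K p g) ∘ₗ (Vodd p).subtype) := by
    refine LinearMap.ext fun f => ?_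
    ext x
    have := (rho hp g f).2 x
    rw [rho_apply] at this
    simp only [q, LinearMap.comp_apply, Submodule.subtype_apply, LinearMap.coe_mk, AddHom.coe_mk,
      Matrix.toLin'_apply, rho_apply, this]
    ring
  have h2 : (Matrix.toLin' (K p g) ∘ₗ (Vodd p).subtype) ∘ₗ q =
      Matrix.toLin' (Matrix.of fun x y => (K p g x y - K p g x (-y)) / 2) := by
    refine LinearMap.ext fun f => ?_
    ext x
    simp only [q, LinearMap.comp_apply, Submodule.subtype_apply, LinearMap.coe_mk, AddHom.coe_mk,
      Matrix.toLin'_apply, Matrix.mulVec, dotProduct, Matrix.of_apply]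
    have e : ∑ y, K p g x y * f (-y) = ∑ y, K p g x (-y) * f y :=
      Fintype.sum_equiv (Equiv.neg _) _ _ fun y => by simp
    have e1 : ∀ y, K p g x y * ((f y - f (-y)) / 2) =
      (K p g x y * f y) / 2 - (K p g x y * f (-y)) / 2 := fun y => by ring
    have e2 : ∀ y, (K p g x y - K p g x (-y)) / 2 * f y =
      (K p g x y * f y) / 2 - (K p g x (-y) * f y) / 2 := fun y => by ring
    simp_rw [e1, e2, Finset.sum_sub_distrib, ← Finset.sum_div, e]
  rw [h1, LinearMap.trace_comp_comm', h2, Matrix.trace_toLin'_eq, Matrix.trace]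
  simp only [Matrix.diag_apply, Matrix.of_apply]
  rw [← Finset.sum_div, Finset.sum_sub_distrib]

/-- The basic odd functions. -/
noncomputable def e (y : ZMod p) : Vodd p :=
  ⟨fun x => (if x = y then 1 else 0) - (if x = -y then 1 else 0), by
    intro x
    simp only [neg_inj, neg_eq_iff_eq_neg (a := x) (b := y)]
    ring⟩

lemma e_span (f : Vodd p) : f = (1 / 2 : ℂ) • ∑ y, f.1 y • e y := by
  ext x
  have h := f.2 x
  have : ∀ y : ZMod p, x = -y ↔ y = -x := fun y => by
    constructor <;> rintro rfl <;> simp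
  simp [e, mul_sub, Finset.sum_sub_distrib, this, h]
  ring

lemma irred (hp : p % 4 = 3) (W : Submodule ℂ (Vodd p))
    (hW : ∀ g, ∀ x ∈ W, rho hp g x ∈ W) : W = ⊥ ∨ W = ⊤ := by
  rw [or_iff_not_imp_left]
  intro hne
  obtain ⟨f, hfW, hf⟩ := W.exists_mem_ne_zero_of_ne_bot hne
  obtain ⟨x0, hx0⟩ : ∃ x0, f.1 x0 ≠ 0 := by
    by_contra! h
    apply hf
    ext x
    simp [h]
  have hx00 : x0 ≠ 0 := by
    rintro rfl
    have := f.2 0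
    rw [neg_zero] at this
    apply hx0
    linear_combination this / 2
  have hxn : x0 ≠ -x0 := by
    intro h
    have : 2 * x0 = 0 := by linear_combination h
    simp [two_ne hp, hx00] at this
  have he0 : e x0 ∈ W := by
    let u : ZMod p → SpecialLinearGroup (Fin 2) (ZMod p) := fun b =>
      ⟨!![1, b; 0, 1], by simp [Matrix.det_fin_two]⟩
    have h1 : ∑ b, psi p (-b * x0 ^ 2) • rho hp (u b) f ∈ W :=
      W.sum_mem fun b _ => W.smul_mem _ (hW _ _ hfW)
    have h2 : ∑ b, psi p (-b * x0 ^ 2) • rho hp (u b) f = ((p : ℂ) * f.1 x0) • e x0 := by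
      ext x
      have e1 : ∀ b, psi p (-b * x0 ^ 2) * (K p (u b) *ᵥ f.1) x =
          psi p (b * (x ^ 2 - x0 ^ 2)) * f.1 x := by
        intro b
        rw [K_apply_of_c _ (by simp [u])]
        simp only [u, Matrix.of_apply, Matrix.cons_val', Matrix.cons_val_zero, Matrix.cons_val_one,
          Matrix.cons_val_fin_one, map_one, one_mul]
        rw [← mul_assoc, ← AddChar.map_add_eq_mul]
        congr 2; ring
      simp only [Submodule.coe_sum, Submodule.coe_smul, Finset.sum_apply, Pi.smul_apply, smul_eq_mul,
        rho_apply, e1]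
      rw [← Finset.sum_mul, sum_lin]
      simp only [sub_eq_zero, sq_eq_sq_iff_eq_or_eq_neg, e]
      by_cases hx : x = x0
      · subst hx; simp [hxn]
      · by_cases hx' : x = -x0
        · subst hx'
          have := f.2 x0
          simp [this, hxn.symm]
        · simp [hx, hx']
    rw [h2] at h1
    exact (W.smul_mem_iff (mul_ne_zero p_ne hx0)).1 h1
  have he : ∀ y, e y ∈ W := by
    intro y
    by_cases hy : y = 0
    · have : e y = 0 := by ext x; simp [e, hy]
      rw [this]; exact W.zero_mem
    · let a : ZMod p := x0 / y
      have ha : a ≠ 0 := div_ne_zero hx00 hy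
      let t : SpecialLinearGroup (Fin 2) (ZMod p) :=
        ⟨!![a, 0; 0, a⁻¹], by simp [Matrix.det_fin_two, ha]⟩
      have h1 := hW t _ he0
      have h2 : rho hp t (e x0) = eps p a • e y := by
        ext x
        rw [rho_apply, K_apply_of_c _ (by simp [t])]
        have i1 : a * x = x0 ↔ x = y := by
          simp only [a]; field_simp
        have i2 : a * x = -x0 ↔ x = -y := by
          simp only [a]; field_simp
        simp [t, e, i1, i2]
      rw [h2] at h1
      have hn : eps p a ≠ 0 := by rcases eps_dich ha with h | h <;> simp [h]
      exact (W.smul_mem_iff hn).1 h1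
  rw [eq_top_iff]
  intro f _
  rw [e_span f]
  exact W.smul_mem _ (W.sum_mem fun y _ => W.smul_mem _ (he y))

lemma sum_diag (g : SpecialLinearGroup (Fin 2) (ZMod p)) (hc : g 1 0 ≠ 0) :
    ∑ x, K p g x x = (G p)⁻¹ * eps p (g 1 0) *
      ∑ x, psi p ((g 0 0 + g 1 1 - 2) / g 1 0 * x ^ 2) := by
  rw [Finset.mul_sum]
  refine Finset.sum_congr rfl fun x _ => ?_
  simp only [K, Matrix.of_apply, k, hc, if_false]
  congr 2; field_simp; ring

lemma sum_adiag (g : SpecialLinearGroup (Fin 2) (ZMod p)) (hc : g 1 0 ≠ 0) :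
    ∑ x, K p g x (-x) = (G p)⁻¹ * eps p (g 1 0) *
      ∑ x, psi p ((g 0 0 + g 1 1 + 2) / g 1 0 * x ^ 2) := by
  rw [Finset.mul_sum]
  refine Finset.sum_congr rfl fun x _ => ?_
  simp only [K, Matrix.of_apply, k, hc, if_false]
  congr 2; field_simp; ring

lemma quad_val (hp : p % 4 = 3) {s c : ZMod p} (hc : c ≠ 0) (hs : s ≠ 0) :
    (G p)⁻¹ * eps p c * ∑ x, psi p (s / c * x ^ 2) = eps p s := by
  rw [sum_quad hp (div_ne_zero hs hc), div_eq_mul_inv, map_mul, eps_inv]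
  have h1 := inv_mul_cancel₀ (G_ne hp)
  have h2 := eps_mul_self hc
  linear_combination (eps p s * eps p c * eps p c) * h1 + eps p s * h2

lemma sum_diag0 (g : SpecialLinearGroup (Fin 2) (ZMod p)) (hc : g 1 0 = 0) (ha : g 0 0 ≠ 1) :
    ∑ x, K p g x x = eps p (g 0 0) := by
  rw [Finset.sum_eq_single 0]
  · simp [K, k, hc]
  · intro x _ hx
    have : x ≠ g 0 0 * x := by
      intro h
      apply ha
      apply mul_right_cancel₀ hx
      rw [one_mul]; exact h.symm
    simp [K, k, hc, this]
  · simp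

lemma sum_adiag0 (g : SpecialLinearGroup (Fin 2) (ZMod p)) (hc : g 1 0 = 0) (ha : g 0 0 ≠ -1) :
    ∑ x, K p g x (-x) = eps p (g 0 0) := by
  rw [Finset.sum_eq_single 0]
  · simp [K, k, hc]
  · intro x _ hx
    have : -x ≠ g 0 0 * x := by
      intro h
      apply ha
      apply mul_right_cancel₀ hx
      rw [neg_one_mul]; exact h.symm
    simp [K, k, hc, this]
  · simp

lemma one_ne_neg (hp : p % 4 = 3) : (1 : ZMod p) ≠ -1 := by
  intro h
  apply two_ne hp
  linear_combination h

lemma val_generic (hp : p % 4 = 3) (g : SpecialLinearGroup (Fin 2) (ZMod p))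
    (h1 : g 0 0 + g 1 1 - 2 ≠ 0) (h2 : g 0 0 + g 1 1 + 2 ≠ 0) :
    LinearMap.trace ℂ _ (rho hp g) ∈ ({-1, 0, 1} : Set ℂ) := by
  rw [trace_rho]
  by_cases hc : g 1 0 = 0
  · have hd := det_eq g
    rw [hc, mul_zero, sub_zero] at hd
    have ha : g 0 0 ≠ 1 := by
      intro h; apply h1; rw [h, one_mul] at hd; rw [h, hd]; ring
    have ha' : g 0 0 ≠ -1 := by
      intro h; apply h2; rw [h] at hd ⊢; linear_combination -hd
    rw [sum_diag0 g hc ha, sum_adiag0 g hc ha']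
    simp
  · rw [sum_diag g hc, sum_adiag g hc, quad_val hp hc h1, quad_val hp hc h2]
    rcases eps_dich h1 with h | h <;> rcases eps_dich h2 with h' | h' <;> rw [h, h'] <;> norm_num

lemma not_real (hp : p % 4 = 3) (s : ℂ) (hs : s = 1 ∨ s = -1) (r : ℂ) (z : ℝ) (hr : r = 1 ∨ r = -1) :
    (z : ℂ) ≠ (s * G p - r) / 2 := by
  intro h
  have h2 : ∃ w : ℝ, (w : ℂ) = G p := by
    rcases hs with rfl | rfl <;> rcases hr with rfl | rfl
    · exact ⟨2 * z + 1, by push_cast; rw [h]; ring⟩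
    · exact ⟨2 * z - 1, by push_cast; rw [h]; ring⟩
    · exact ⟨-(2 * z + 1), by push_cast; rw [h]; ring⟩
    · exact ⟨-(2 * z - 1), by push_cast; rw [h]; ring⟩
  obtain ⟨w, hw⟩ := h2
  have h3 := G_sq hp
  rw [← hw] at h3
  have h4 : w ^ 2 = -(p : ℝ) := by exact_mod_cast h3
  have h5 : (0 : ℝ) < p := by exact_mod_cast (Fact.out : p.Prime).pos
  nlinarith [sq_nonneg w]

lemma val_unip (hp : p % 4 = 3) (g : SpecialLinearGroup (Fin 2) (ZMod p))
    (h1 : g 0 0 + g 1 1 = 2) (hg : g ≠ 1) :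
    LinearMap.trace ℂ _ (rho hp g) ∉ Set.range ((↑) : ℝ → ℂ) := by
  rintro ⟨z, hz⟩
  rw [trace_rho] at hz
  by_cases hc : g 1 0 = 0
  · have hd := det_eq g
    rw [hc, mul_zero, sub_zero] at hd
    have ha : g 0 0 = 1 := by
      have : (g 0 0 - 1) ^ 2 = 0 := by linear_combination g 0 0 * h1 - hd
      have := pow_eq_zero_iff (two_ne_zero) |>.1 this
      linear_combination this
    have hd1 : g 1 1 = 1 := by linear_combination h1 - ha
    have hb : g 0 1 ≠ 0 := by
      intro hb
      apply hg
      apply Subtype.ext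
      ext i j
      fin_cases i <;> fin_cases j <;> simp [ha, hb, hc, hd1]
    rw [sum_adiag0 g hc (by rw [ha]; exact one_ne_neg hp)] at hz
    have h2 : ∑ x, K p g x x = eps p (g 0 1) * G p := by
      rw [← sum_quad hp hb]
      refine Finset.sum_congr rfl fun x _ => ?_
      simp [K, k, hc, ha]
    rw [h2, ha, map_one] at hz
    exact not_real hp _ (eps_dich hb) 1 z (Or.inl rfl) hz
  · have h4 : g 0 0 + g 1 1 + 2 ≠ 0 := by
      rw [h1]
      have : (2 : ZMod p) + 2 = 2 * 2 := by ring
      rw [this]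
      exact mul_ne_zero (two_ne hp) (two_ne hp)
    have h5 : g 0 0 + g 1 1 - 2 = 0 := by rw [h1]; ring
    rw [sum_diag g hc, sum_adiag g hc, quad_val hp hc h4, h5] at hz
    simp only [zero_div, zero_mul, AddChar.map_zero_eq_one, Finset.sum_const, Finset.card_univ,
      ZMod.card, nsmul_eq_mul, mul_one] at hz
    have h6 : (G p)⁻¹ * eps p (g 1 0) * p = (- eps p (g 1 0)) * G p := by
      linear_combination (eps p (g 1 0)) * G_inv hp
    rw [h6] at hz
    refine not_real hp _ ?_ _ z (eps_dich h4) hz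
    rcases eps_dich hc with h | h <;> simp [h]

lemma val_one (hp : p % 4 = 3) :
    LinearMap.trace ℂ _ (rho hp 1) = ((p : ℂ) - 1) / 2 := by
  rw [trace_rho, sum_adiag0 1 (by simp) (by simpa using one_ne_neg hp), K_one]
  simp

lemma mk_neg (g : SpecialLinearGroup (Fin 2) (ZMod p)) :
    (QuotientGroup.mk (-g) : ProjectiveSpecialLinearGroup (Fin 2) (ZMod p)) = QuotientGroup.mk g := by
  rw [QuotientGroup.eq]
  rw [Matrix.SpecialLinearGroup.mem_center_iff]
  refine ⟨-1, by simp, ?_⟩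
  have : (-g)⁻¹ * g = -1 := by
    rw [inv_mul_eq_iff_eq_mul]; simp
  rw [this]
  ext i j; fin_cases i <;> fin_cases j <;> simp

lemma det_sub_one (g : SpecialLinearGroup (Fin 2) (ZMod p)) :
    (g.1 - 1).det = 2 - (g 0 0 + g 1 1) := by
  have := det_eq g
  rw [Matrix.det_fin_two]
  simp
  linear_combination this

lemma tr_of_pow (g : SpecialLinearGroup (Fin 2) (ZMod p)) (h : g ^ p = 1) :
    g 0 0 + g 1 1 = 2 := by
  have h1 : (g.1 - 1) ^ p = 0 := by
    rw [sub_pow_char_of_commute (p := p) (Commute.one_right _), one_pow]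
    have : (g ^ p).1 = 1 := by rw [h]; rfl
    rw [Matrix.SpecialLinearGroup.coe_pow] at this
    rw [this, sub_self]
  have h2 : (g.1 - 1).det ^ p = 0 := by
    rw [← Matrix.det_pow, h1, Matrix.det_zero]
  have h3 := pow_eq_zero_iff (Fact.out : p.Prime).ne_zero |>.1 h2
  rw [det_sub_one] at h3
  linear_combination -h3

lemma pow_of_tr (hp : p % 4 = 3) (g : SpecialLinearGroup (Fin 2) (ZMod p))
    (h : g 0 0 + g 1 1 = 2) : g ^ p = 1 := by
  have h2 : (g.1 - 1) ^ 2 = 0 := by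
    have hd := det_eq g
    rw [sq]
    ext i j
    fin_cases i <;> fin_cases j <;> simp [Matrix.mul_apply, Fin.sum_univ_two]
    · linear_combination g 0 0 * h - hd
    · linear_combination g 0 1 * h
    · linear_combination g 1 0 * h
    · linear_combination g 1 1 * h - hd
  have h1 : (g.1 - 1) ^ p = 0 := pow_eq_zero_of_le (by omega : 2 ≤ p) h2
  rw [sub_pow_char_of_commute (p := p) (Commute.one_right _), one_pow] at h1
  apply Subtype.ext
  rw [Matrix.SpecialLinearGroup.coe_pow]
  exact sub_eq_zero.1 h1

lemma mk_eq_one {g : SpecialLinearGroup (Fin 2) (ZMod p)}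
    (h : (QuotientGroup.mk g : ProjectiveSpecialLinearGroup (Fin 2) (ZMod p)) = 1) :
    g = 1 ∨ g = -1 :=
  center_cases ((QuotientGroup.eq_one_iff g).1 h)

lemma exists_rep (hp : p % 4 = 3) (g : ProjectiveSpecialLinearGroup (Fin 2) (ZMod p))
    (hg : g ^ p = 1) : ∃ s : SpecialLinearGroup (Fin 2) (ZMod p),
      QuotientGroup.mk s = g ∧ s 0 0 + s 1 1 = 2 := by
  obtain ⟨s, rfl⟩ := QuotientGroup.mk_surjective g
  rw [← QuotientGroup.mk_pow] at hg
  rcases mk_eq_one hg with h | h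
  · exact ⟨s, rfl, tr_of_pow s h⟩
  · refine ⟨-s, mk_neg s, tr_of_pow _ ?_⟩
    rw [Odd.neg_pow (Nat.odd_iff.2 (by omega)), h, neg_neg]

lemma nonreal (hp : p % 4 = 3) (g : ProjectiveSpecialLinearGroup (Fin 2) (ZMod p))
    (hg : orderOf g = p) : LinearMap.trace ℂ _ (tau hp g) ∉ Set.range ((↑) : ℝ → ℂ) := by
  have hgp : g ^ p = 1 := by
    have := pow_orderOf_eq_one g
    rwa [hg] at this
  obtain ⟨s, rfl, hs⟩ := exists_rep hp g hgp
  rw [tau_mk]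
  refine val_unip hp s hs ?_
  rintro rfl
  rw [QuotientGroup.mk_one, orderOf_one] at hg
  exact (Fact.out : p.Prime).one_lt.ne hg

lemma small (hp : p % 4 = 3) (g : ProjectiveSpecialLinearGroup (Fin 2) (ZMod p))
    (hg1 : g ≠ 1) (hg : orderOf g ≠ p) :
    LinearMap.trace ℂ _ (tau hp g) ∈ ({-1, 0, 1} : Set ℂ) := by
  obtain ⟨s, rfl⟩ := QuotientGroup.mk_surjective g
  have key : ∀ t : SpecialLinearGroup (Fin 2) (ZMod p),
      (QuotientGroup.mk t : ProjectiveSpecialLinearGroup (Fin 2) (ZMod p)) = QuotientGroup.mk s →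
      t 0 0 + t 1 1 ≠ 2 := by
    intro t ht h
    have h1 := pow_of_tr hp t h
    apply hg
    apply orderOf_eq_prime _ hg1
    rw [← ht, ← QuotientGroup.mk_pow, h1, QuotientGroup.mk_one]
  rw [tau_mk]
  refine val_generic hp s ?_ ?_
  · intro h; exact key s rfl (by linear_combination h)
  · intro h
    refine key (-s) (mk_neg s) ?_
    simp
    linear_combination -h

lemma exists_order (hp : p % 4 = 3) :
    ∃ g : ProjectiveSpecialLinearGroup (Fin 2) (ZMod p), orderOf g = p := by
  let u : SpecialLinearGroup (Fin 2) (ZMod p) := ⟨!![1, 1; 0, 1], by simp [Matrix.det_fin_two]⟩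
  refine ⟨QuotientGroup.mk u, orderOf_eq_prime ?_ ?_⟩
  · rw [← QuotientGroup.mk_pow, pow_of_tr hp u (by simp [u]; norm_num), QuotientGroup.mk_one]
  · intro h
    rcases mk_eq_one h with h | h
    · have := congrArg (fun g : SpecialLinearGroup (Fin 2) (ZMod p) => g 0 1) h
      simp [u] at this
    · have := congrArg (fun g : SpecialLinearGroup (Fin 2) (ZMod p) => g 0 1) h
      simp [u] at this

lemma nontriv (hp : p % 4 = 3) : Nontrivial (Vodd p) := by
  refine ⟨e 1, 0, fun h => ?_⟩
  have := congrArg (fun f : Vodd p => f.1 1) h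
  simp [e, one_ne_neg hp] at this

end
end WeilAux

/-- (Lemma `l:pslcomplexchar`.) For a prime `p ≡ -1 (mod 4)` there is
an irreducible complex character `χ` of `PSL(2,p)` with `χ(1) = (p-1)/2`, such that
`χ(g) ∉ ℝ` whenever `g` has order `p`, and `χ(g) ∈ {-1,0,1}` for all other
nonidentity `g`; in particular `χ ≠ χ̄`. -/
theorem stmt9 (p : ℕ) [Fact p.Prime] (hp : p % 4 = 3) :
    ∃ χ : ProjectiveSpecialLinearGroup (Fin 2) (ZMod p) → ℂ,
      IsIrrChar _ χ ∧
      χ 1 = ((p : ℂ) - 1) / 2 ∧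
      (∀ g, orderOf g = p → χ g ∉ Set.range ((↑) : ℝ → ℂ)) ∧
      (∀ g, g ≠ 1 → orderOf g ≠ p → χ g ∈ ({-1, 0, 1} : Set ℂ)) ∧
      χ ≠ fun g => (starRingEnd ℂ) (χ g) := by
  refine ⟨fun g => LinearMap.trace ℂ _ (WeilAux.tau hp g), ?_, ?_, ?_, ?_, ?_⟩
  · refine ⟨WeilAux.Vodd p, inferInstance, inferInstance, inferInstance, WeilAux.tau hp,
      WeilAux.nontriv hp, ?_, fun g => rfl⟩
    intro W hW
    exact WeilAux.irred hp W fun g x hx => hW (QuotientGroup.mk g) x hx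
  · exact WeilAux.val_one hp
  · exact WeilAux.nonreal hp
  · exact WeilAux.small hp
  · intro h
    obtain ⟨g, hg⟩ := WeilAux.exists_order hp
    refine WeilAux.nonreal hp g hg ?_
    obtain ⟨r, hr⟩ := Complex.conj_eq_iff_real.1 (congrFun h g).symm
    exact ⟨r, hr.symm⟩
end

section
/- There exist abstract regular polytopes (equivalently, string C-groups G with distinguished vertex-stabilizer subgroup H) possessing a pure realization of complex type with arbitrarily large essential Wythoff dimension. Concretely: for every N there is a prime p ≡ -1 (mod 4), p ≡ 1 (mod 7), such that G = PSL(2,p) is a string C-group with vertex stabilizer H dihedral of order 14, and an irreducible complex character χ of G with χ ≠ χ̄ and ⟨Ind_H^G(1), χ⟩ ≥ (p-1)/28 - 13/14 > N. -/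
open Matrix

/-- Inner product of class functions on a (finite) group, via `Nat.card` and `finsum`. -/
noncomputable def ipCF' {G : Type} [Group G] (α β : G → ℂ) : ℂ :=
  (Nat.card G : ℂ)⁻¹ * ∑ᶠ g : G, α g * (starRingEnd ℂ) (β g)


namespace Weil
variable {p : ℕ} [Fact p.Prime]

/-- complex-valued quadratic character -/
noncomputable def q (p : ℕ) [Fact p.Prime] : MulChar (ZMod p) ℂ :=
  (quadraticChar (ZMod p)).ringHomComp (Int.castRingHom ℂ)

/-- standard additive character -/
noncomputable def ps (p : ℕ) [Fact p.Prime] : AddChar (ZMod p) ℂ := ZMod.stdAddChar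

/-- quadratic Gauss sum -/
noncomputable def gs (p : ℕ) [Fact p.Prime] : ℂ := ∑ x : ZMod p, ps p (x ^ 2)

lemma ringChar_ne (hp : p % 4 = 3) : ringChar (ZMod p) ≠ 2 := by
  rw [ZMod.ringChar_zmod_n]; omega

lemma two_ne (hp : p % 4 = 3) : (2 : ZMod p) ≠ 0 := by
  exact Ring.two_ne_zero (ringChar_ne hp)

lemma ps_prim : (ps p).IsPrimitive := ZMod.isPrimitive_stdAddChar p

lemma q_sq {a : ZMod p} (ha : a ≠ 0) : q p a * q p a = 1 := by
  have := quadraticChar_sq_one ha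
  simp only [q, MulChar.ringHomComp_apply]
  rw [← map_mul, ← sq, this, map_one]

lemma q_inv (a : ZMod p) : q p a⁻¹ = q p a := by
  by_cases ha : a = 0
  · simp [ha]
  · have h1 : q p a * q p a⁻¹ = 1 := by rw [← map_mul, mul_inv_cancel₀ ha, map_one]
    calc q p a⁻¹ = (q p a * q p a) * q p a⁻¹ := by rw [q_sq ha, one_mul]
      _ = q p a * (q p a * q p a⁻¹) := by ring
      _ = q p a := by rw [h1, mul_one]

lemma q_dich {a : ZMod p} (ha : a ≠ 0) : q p a = 1 ∨ q p a = -1 := by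
  rcases quadraticChar_dichotomy ha with h | h <;> simp [q, MulChar.ringHomComp_apply, h]

lemma neg_one_not_square (hp : p % 4 = 3) : ¬ IsSquare (-1 : ZMod p) := by
  rw [ZMod.exists_sq_eq_neg_one_iff]; omega

lemma q_neg_one (hp : p % 4 = 3) : q p (-1) = -1 := by
  have := quadraticChar_neg_one_iff_not_isSquare.mpr (neg_one_not_square hp)
  simp [q, MulChar.ringHomComp_apply, this]

lemma sum_sq (hp : p % 4 = 3) (F : ZMod p → ℂ) :
    ∑ z : ZMod p, F (z ^ 2) = ∑ t : ZMod p, (q p t + 1) * F t := by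
  classical
  rw [← Finset.sum_fiberwise Finset.univ (fun z : ZMod p => z ^ 2)]
  refine Finset.sum_congr rfl fun t _ => ?_
  rw [Finset.sum_congr rfl (g := fun _ => F t) (by intro z hz; simp at hz; simp [hz])]
  rw [Finset.sum_const, nsmul_eq_mul]
  congr 1
  have := quadraticChar_card_sqrts (ringChar_ne hp) t
  have h2 : (Finset.univ.filter fun z : ZMod p => z ^ 2 = t) = {x : ZMod p | x ^ 2 = t}.toFinset := by
    ext; simp
  rw [h2]
  have h3 := congrArg (Int.cast : ℤ → ℂ) this
  push_cast at h3
  rw [h3]; simp [q, MulChar.ringHomComp_apply]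

lemma sum_ps_mul (b : ZMod p) : ∑ x : ZMod p, ps p (x * b) = if b = 0 then (p : ℂ) else 0 := by
  rw [AddChar.sum_mulShift b ps_prim, ZMod.card]; split_ifs <;> simp

lemma sum_ps_sq (hp : p % 4 = 3) {A : ZMod p} (hA : A ≠ 0) :
    ∑ z : ZMod p, ps p (A * z ^ 2) = q p A * gaussSum (q p) (ps p) := by
  rw [sum_sq hp (fun t => ps p (A * t))]
  simp only [add_mul, one_mul, Finset.sum_add_distrib]
  have h0 : ∑ x : ZMod p, ps p (A * x) = 0 := by
    have := sum_ps_mul A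
    rw [if_neg hA] at this
    simpa [mul_comm] using this
  rw [h0, add_zero]
  have h1 := gaussSum_mulShift (q p) (ps p) (Units.mk0 A hA)
  rw [← h1, ← mul_assoc]
  simp only [Units.val_mk0, q_sq hA, one_mul]
  simp [gaussSum, AddChar.mulShift_apply]

lemma gs_eq (hp : p % 4 = 3) : gs p = gaussSum (q p) (ps p) := by
  have := sum_ps_sq hp (one_ne_zero (α := ZMod p))
  simpa [gs] using this

lemma gs_sq (hp : p % 4 = 3) : gs p * gs p = - (p : ℂ) := by
  rw [gs_eq hp, ← sq, gaussSum_sq _ _ ps_prim, q_neg_one hp, ZMod.card]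
  · ring
  · intro h
    have := q_neg_one hp
    rw [h, MulChar.one_apply (by simp)] at this
    norm_num at this
  · exact quadraticChar_isQuadratic _ |>.comp _

lemma gs_ne (hp : p % 4 = 3) : gs p ≠ 0 := by
  intro h
  have := gs_sq hp
  rw [h] at this
  have h2 : (p : ℂ) ≠ 0 := by exact_mod_cast (Fact.out : p.Prime).ne_zero
  apply h2; simpa using this

lemma gauss_quad (hp : p % 4 = 3) {A : ZMod p} (hA : A ≠ 0) (B : ZMod p) :
    ∑ z : ZMod p, ps p (A * z ^ 2 - 2 * B * z) = q p A * gs p * ps p (- (B ^ 2 / A)) := by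
  rw [gs_eq hp, ← sum_ps_sq hp hA, Finset.sum_mul]
  refine Fintype.sum_bijective (fun z => z - B / A) (Equiv.subRight (B / A)).bijective _ _ fun z => ?_
  rw [← AddChar.map_add_eq_mul]
  congr 1
  field_simp
  ring

lemma q_mul (a b : ZMod p) : q p (a * b) = q p a * q p b := map_mul _ _ _

lemma ps_add (a b : ZMod p) : ps p (a + b) = ps p a * ps p b := AddChar.map_add_eq_mul _ _ _

/-- The kernel of the Weil representation, in terms of matrix entries. -/
noncomputable def Kf (a b c d x y : ZMod p) : ℂ :=
  if c = 0 then (if y = a * x then q p a * ps p (a * b * x ^ 2) else 0)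
  else (gs p)⁻¹ * q p c * ps p ((a * x ^ 2 - 2 * x * y + d * y ^ 2) / c)

lemma Kf_mul (hp : p % 4 = 3) {a1 b1 c1 d1 a2 b2 c2 d2 : ZMod p}
    (D1 : a1 * d1 - b1 * c1 = 1) (D2 : a2 * d2 - b2 * c2 = 1) (x y : ZMod p) :
    ∑ z, Kf a1 b1 c1 d1 x z * Kf a2 b2 c2 d2 z y =
      Kf (a1 * a2 + b1 * c2) (a1 * b2 + b1 * d2) (c1 * a2 + d1 * c2) (c1 * b2 + d1 * d2) x y := by
  have h2 := two_ne hp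
  have hg := gs_ne hp
  by_cases hc1 : c1 = 0
  · subst hc1
    have ha1 : a1 ≠ 0 := by rintro rfl; simp at D1
    have hd1 : d1 = a1⁻¹ := by field_simp; linear_combination D1
    subst hd1
    simp only [Kf, if_true, ite_mul, zero_mul, Finset.sum_ite_eq',
      Finset.mem_univ, zero_add]
    by_cases hc2 : c2 = 0
    · subst hc2
      simp only [mul_zero, if_true, add_zero]
      by_cases hy : y = a2 * (a1 * x)
      · rw [if_pos hy, if_pos (by rw [hy]; ring), q_mul]
        have : a1 * a2 * (a1 * b2 + b1 * d2) * x ^ 2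
          = (a1 * b1 * x ^ 2) + a2 * b2 * (a1 * x) ^ 2 := by
            linear_combination (a1 * b1 * x ^ 2) * D2
        rw [this, AddChar.map_add_eq_mul]
        ring
      · rw [if_neg hy, if_neg (by intro h; apply hy; rw [h]; ring), mul_zero]
    · have hc3 : a1⁻¹ * c2 ≠ 0 := by positivity
      rw [if_neg hc2, if_neg hc3, q_mul, q_inv]
      have : ((a1 * a2 + b1 * c2) * x ^ 2 - 2 * x * y + a1⁻¹ * d2 * y ^ 2) / (a1⁻¹ * c2) =
        a1 * b1 * x ^ 2 + (a2 * (a1 * x) ^ 2 - 2 * (a1 * x) * y + d2 * y ^ 2) / c2 := by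
          field_simp; ring
      rw [this, AddChar.map_add_eq_mul]
      ring
  by_cases hc2 : c2 = 0
  · subst hc2
    have ha2 : a2 ≠ 0 := by rintro rfl; simp at D2
    have hd2 : d2 = a2⁻¹ := by field_simp; linear_combination D2
    subst hd2
    have hc3 : c1 * a2 ≠ 0 := mul_ne_zero hc1 ha2
    have hz : ∀ z : ZMod p, y = a2 * z ↔ z = a2⁻¹ * y := by
      intro z
      constructor
      · rintro rfl; field_simp
      · rintro rfl; field_simp
    simp only [Kf, if_true, mul_zero, add_zero, if_neg hc1, if_neg hc3, hz, mul_ite,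
      Finset.sum_ite_eq', Finset.mem_univ]
    have : (a1 * a2 * x ^ 2 - 2 * x * y + (c1 * b2 + d1 * a2⁻¹) * y ^ 2) / (c1 * a2) =
      (a1 * x ^ 2 - 2 * x * (a2⁻¹ * y) + d1 * (a2⁻¹ * y) ^ 2) / c1 + a2 * b2 * (a2⁻¹ * y) ^ 2 := by
        field_simp; ring
    rw [this, AddChar.map_add_eq_mul, q_mul]
    ring
  have hs : ∀ z : ZMod p, Kf a1 b1 c1 d1 x z * Kf a2 b2 c2 d2 z y =
      (gs p)⁻¹ * (gs p)⁻¹ * (q p c1 * q p c2) * ps p (a1 * x ^ 2 / c1 + d2 * y ^ 2 / c2) *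
       ps p ((c1 * a2 + d1 * c2) / (c1 * c2) * z ^ 2 - 2 * (x / c1 + y / c2) * z) := by
    intro z
    simp only [Kf, if_neg hc1, if_neg hc2]
    have : (a1 * x ^ 2 - 2 * x * z + d1 * z ^ 2) / c1 + (a2 * z ^ 2 - 2 * z * y + d2 * y ^ 2) / c2
      = (a1 * x ^ 2 / c1 + d2 * y ^ 2 / c2) +
        ((c1 * a2 + d1 * c2) / (c1 * c2) * z ^ 2 - 2 * (x / c1 + y / c2) * z) := by
          field_simp; ring
    have h3 := congrArg (ps p) this
    rw [AddChar.map_add_eq_mul, AddChar.map_add_eq_mul] at h3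
    linear_combination ((gs p)⁻¹ * (gs p)⁻¹ * (q p c1 * q p c2)) * h3
  rw [Finset.sum_congr rfl (fun z _ => hs z), ← Finset.mul_sum]
  by_cases hc3 : c1 * a2 + d1 * c2 = 0
  · have hs2 : ∀ z : ZMod p, (c1 * a2 + d1 * c2) / (c1 * c2) * z ^ 2 - 2 * (x / c1 + y / c2) * z
      = z * (- 2 * (x / c1 + y / c2)) := by intro z; rw [hc3]; ring
    simp only [hs2, sum_ps_mul]
    have ha3 : a1 * a2 + b1 * c2 = - (c2 / c1) := by
      field_simp
      linear_combination a1 * hc3 - c2 * D1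
    simp only [Kf, if_pos hc3, ha3]
    by_cases hy : y = -(c2 / c1) * x
    · have h4 : -2 * (x / c1 + y / c2) = 0 := by rw [hy]; field_simp; ring
      rw [if_pos h4, if_pos hy]
      have h5 : -(c2 / c1) * (a1 * b2 + b1 * d2) * x ^ 2 =
        a1 * x ^ 2 / c1 + d2 * y ^ 2 / c2 := by
          rw [hy]; field_simp
          linear_combination c2 * d2 * x ^ 2 * D1 + a1 * c1 * x ^ 2 * D2
            - a1 * d2 * x ^ 2 * hc3
      rw [h5, show -(c2 / c1) = (-1) * (c2 * c1⁻¹) by field_simp, q_mul, q_mul, q_inv,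
        q_neg_one hp]
      have h6 := gs_sq hp
      have h7 : (gs p)⁻¹ * (gs p)⁻¹ * (p : ℂ) = -1 := by
        field_simp; linear_combination h6
      linear_combination (q p c1 * q p c2) * ps p (a1 * x ^ 2 / c1 + d2 * y ^ 2 / c2) * h7
    · rw [if_neg, if_neg hy, mul_zero]
      intro h4
      apply hy
      have : x / c1 + y / c2 = 0 := by
        rcases mul_eq_zero.mp h4 with h | h
        · exact absurd h (neg_ne_zero.mpr h2)
        · exact h
      field_simp at this ⊢
      linear_combination this
  · have hA : (c1 * a2 + d1 * c2) / (c1 * c2) ≠ 0 := by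
      exact div_ne_zero hc3 (mul_ne_zero hc1 hc2)
    rw [gauss_quad hp hA]
    simp only [Kf, if_neg hc3]
    have hq : q p ((c1 * a2 + d1 * c2) / (c1 * c2)) = q p (c1 * a2 + d1 * c2) * (q p c1 * q p c2) := by
      rw [div_eq_mul_inv, q_mul, q_inv, q_mul]
    have h5 : ((a1 * a2 + b1 * c2) * x ^ 2 - 2 * x * y + (c1 * b2 + d1 * d2) * y ^ 2) /
        (c1 * a2 + d1 * c2) = (a1 * x ^ 2 / c1 + d2 * y ^ 2 / c2) +
        (-((x / c1 + y / c2) ^ 2 / ((c1 * a2 + d1 * c2) / (c1 * c2)))) := by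
      have hb1 : b1 = (a1 * d1 - 1) / c1 := by field_simp; linear_combination -D1
      have hb2 : b2 = (a2 * d2 - 1) / c2 := by field_simp; linear_combination -D2
      rw [hb1, hb2]
      generalize hcc : c1 * a2 + d1 * c2 = c3 at *
      have ha2 : a2 = (c3 - d1 * c2) / c1 := by field_simp; linear_combination hcc
      rw [ha2]
      field_simp
      ring
    rw [h5, ps_add (a1 * x ^ 2 / c1 + d2 * y ^ 2 / c2), hq]
    have e1 := q_sq hc1
    have e2 := q_sq hc2
    have e3 : (gs p)⁻¹ * gs p = 1 := inv_mul_cancel₀ hg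
    generalize ps p (a1 * x ^ 2 / c1 + d2 * y ^ 2 / c2) = P1
    generalize ps p (-((x / c1 + y / c2) ^ 2 / ((c1 * a2 + d1 * c2) / (c1 * c2)))) = P2
    calc _ = ((gs p)⁻¹ * gs p) * (q p c1 * q p c1) * (q p c2 * q p c2) * ((gs p)⁻¹ * q p (c1 * a2 + d1 * c2) * (P1 * P2)) := by ring
      _ = _ := by rw [e1, e2, e3]; ring

end Weil


namespace Weil
variable {p : ℕ} [Fact p.Prime]

/-- nonzero squares -/
def R (p : ℕ) : Type := {x : ZMod p // x ≠ 0 ∧ IsSquare x}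

noncomputable instance : Fintype (R p) := by
  classical
  unfold R
  infer_instance

noncomputable instance : DecidableEq (R p) := Classical.decEq _

lemma sq_or (hp : p % 4 = 3) {x : ZMod p} (hx : x ≠ 0) : IsSquare x ∨ IsSquare (-x) := by
  by_contra! h
  have h1 := quadraticChar_neg_one_iff_not_isSquare.mpr h.1
  have h2 := quadraticChar_neg_one_iff_not_isSquare.mpr h.2
  have h3 := quadraticChar_neg_one_iff_not_isSquare.mpr (neg_one_not_square hp)
  rw [neg_eq_neg_one_mul, map_mul, h1, h3] at h2
  norm_num at h2

lemma not_both (hp : p % 4 = 3) {x : ZMod p} (hx : x ≠ 0) (h1 : IsSquare x) : ¬ IsSquare (-x) := by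
  intro h2
  apply neg_one_not_square hp
  have : (-1 : ZMod p) = (-x) / x := by field_simp
  rw [this]
  exact h2.div h1

lemma sum_half (hp : p % 4 = 3) (F : ZMod p → ℂ) :
    ∑ z : ZMod p, F z = F 0 + ∑ z : R p, (F z.1 + F (-z.1)) := by
  classical
  have hR : ∀ E : ZMod p → ℂ, ∑ z : R p, E z.1 = ∑ z, if z ≠ 0 ∧ IsSquare z then E z else 0 := by
    intro E
    rw [← Finset.sum_filter]
    symm
    apply Finset.sum_subtype
    intro x; simp
  have h0 : F 0 = ∑ z : ZMod p, if z = 0 then F z else 0 := by simp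
  rw [Finset.sum_add_distrib, hR F, hR (fun z => F (-z)), h0]
  have h1 : (∑ z : ZMod p, if z ≠ 0 ∧ IsSquare z then F (-z) else 0) =
      ∑ z : ZMod p, if z ≠ 0 ∧ IsSquare (-z) then F z else 0 := by
    refine Fintype.sum_bijective (fun z => -z) (Equiv.neg _).bijective _ _ fun z => ?_
    simp
  rw [h1, ← Finset.sum_add_distrib, ← Finset.sum_add_distrib]
  refine Finset.sum_congr rfl fun z _ => ?_
  by_cases hz : z = 0
  · simp [hz]
  · rcases sq_or hp hz with h | h
    · simp [hz, h, not_both hp hz h]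
    · have := not_both hp (neg_ne_zero.mpr hz) h
      rw [neg_neg] at this
      simp [hz, h, this]

lemma R_ne_neg (hp : p % 4 = 3) (x y : R p) : x.1 ≠ - y.1 := by
  intro h
  apply not_both hp y.2.1 y.2.2
  rw [← h]; exact x.2.2

/-- kernel of a matrix -/
noncomputable def K (g : SpecialLinearGroup (Fin 2) (ZMod p)) (x y : ZMod p) : ℂ :=
  Kf (g 0 0) (g 0 1) (g 1 0) (g 1 1) x y

lemma det_eq (g : SpecialLinearGroup (Fin 2) (ZMod p)) :
    g 0 0 * g 1 1 - g 0 1 * g 1 0 = 1 := by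
  have := g.det_coe
  rwa [Matrix.det_fin_two] at this

lemma K_mul (hp : p % 4 = 3) (g h : SpecialLinearGroup (Fin 2) (ZMod p)) (x y : ZMod p) :
    ∑ z, K g x z * K h z y = K (g * h) x y := by
  have e (i j : Fin 2) : (g * h) i j = g i 0 * h 0 j + g i 1 * h 1 j := by
    simp [Matrix.mul_apply, Fin.sum_univ_two]
  simp only [K, e]
  exact Kf_mul hp (det_eq g) (det_eq h) x y

lemma K_neg (g : SpecialLinearGroup (Fin 2) (ZMod p)) (x y : ZMod p) :
    K g (-x) (-y) = K g x y := by
  simp only [K, Kf, mul_neg, neg_inj, neg_sq, neg_mul, neg_neg]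

lemma K_neg' (g : SpecialLinearGroup (Fin 2) (ZMod p)) (x y : ZMod p) :
    K g (-x) y = K g x (-y) := by
  rw [← K_neg g x (-y), neg_neg]

/-- matrix of the odd part -/
noncomputable def M (g : SpecialLinearGroup (Fin 2) (ZMod p)) : Matrix (R p) (R p) ℂ :=
  Matrix.of fun x y => K g x.1 y.1 - K g x.1 (-y.1)

lemma M_mul (hp : p % 4 = 3) (g h : SpecialLinearGroup (Fin 2) (ZMod p)) :
    M (g * h) = M g * M h := by
  ext x y
  simp only [M, Matrix.mul_apply, Matrix.of_apply]
  rw [← K_mul hp, ← K_mul hp, ← Finset.sum_sub_distrib, sum_half hp]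
  have h0 : K h 0 (-y.1) = K h 0 y.1 := by rw [← K_neg', neg_zero]
  rw [h0, sub_self, zero_add]
  refine Finset.sum_congr rfl fun z _ => ?_
  rw [K_neg' h, K_neg h]
  ring

lemma M_scalar (hp : p % 4 = 3) (g : SpecialLinearGroup (Fin 2) (ZMod p)) (r : ZMod p)
    (hr : r = 1 ∨ r = -1) (h00 : g 0 0 = r) (h01 : g 0 1 = 0) (h10 : g 1 0 = 0) :
    M g = 1 := by
  ext x y
  have hxy : (y.1 = x.1) ↔ x = y := by
    constructor
    · intro h; exact Subtype.ext h.symm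
    · rintro rfl; rfl
  have h1 := R_ne_neg hp y x
  have h2 := R_ne_neg hp x y
  simp only [M, Matrix.of_apply, K, Kf, h00, h01, h10, if_true, Matrix.one_apply]
  rcases hr with rfl | rfl
  · have h3 : ¬ (-y.1 = x.1) := fun h => h2 h.symm
    simp [h3, hxy]
  · have h3 : ¬ (y.1 = -x.1) := h1
    simp [h3, hxy, q_neg_one hp]
    split_ifs <;> simp

/-- the representation of SL2 as a matrix-valued hom -/
noncomputable def Mhom (hp : p % 4 = 3) :
    SpecialLinearGroup (Fin 2) (ZMod p) →* Matrix (R p) (R p) ℂ where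
  toFun := M
  map_one' := M_scalar hp 1 1 (Or.inl rfl) (by simp) (by simp) (by simp)
  map_mul' := M_mul hp

lemma center_pm {g : SpecialLinearGroup (Fin 2) (ZMod p)}
    (hg : g ∈ Subgroup.center (SpecialLinearGroup (Fin 2) (ZMod p))) : g = 1 ∨ g = -1 := by
  obtain ⟨r, hr, h⟩ := Matrix.SpecialLinearGroup.mem_center_iff.mp hg
  have : r = 1 ∨ r = -1 := by
    apply mul_self_eq_one_iff.mp
    rw [← sq]
    simpa using hr
  rcases this with rfl | rfl
  · left; ext i j; rw [← h]; simp
  · right; ext i j; rw [← h]; fin_cases i <;> fin_cases j <;> simp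

lemma mem_center_pm {g : SpecialLinearGroup (Fin 2) (ZMod p)} (h : g = 1 ∨ g = -1) :
    g ∈ Subgroup.center (SpecialLinearGroup (Fin 2) (ZMod p)) := by
  rw [Subgroup.mem_center_iff]
  intro k
  rcases h with rfl | rfl <;> simp

/-- The representation of PSL2. -/
noncomputable def tau (hp : p % 4 = 3) :
    Representation ℂ (ProjectiveSpecialLinearGroup (Fin 2) (ZMod p)) (R p → ℂ) :=
  QuotientGroup.lift _
    ((Matrix.toLinAlgEquiv' : Matrix (R p) (R p) ℂ ≃ₐ[ℂ] _).toMonoidHom.comp (Mhom hp)) (by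
    intro g hg
    have h1 : M g = 1 := by
      rcases center_pm hg with rfl | rfl
      · exact M_scalar hp 1 1 (Or.inl rfl) (by simp) (by simp) (by simp)
      · exact M_scalar hp (-1) (-1) (Or.inr rfl) (by simp) (by simp) (by simp)
    change Matrix.toLinAlgEquiv' (M g) = 1
    rw [h1, map_one])

lemma tau_mk (hp : p % 4 = 3) (g : SpecialLinearGroup (Fin 2) (ZMod p)) :
    tau hp (QuotientGroup.mk g) = Matrix.toLin' (M g) := rfl

/-- upper unipotent -/
def uu (b : ZMod p) : SpecialLinearGroup (Fin 2) (ZMod p) :=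
  ⟨!![1, b; 0, 1], by simp⟩

/-- lower unipotent -/
def ll (b : ZMod p) : SpecialLinearGroup (Fin 2) (ZMod p) :=
  ⟨!![1, 0; b, 1], by simp⟩

/-- diagonal -/
def tt (a b : ZMod p) (h : a * b = 1) : SpecialLinearGroup (Fin 2) (ZMod p) :=
  ⟨!![a, 0; 0, b], by simp [h]⟩

/-- antidiagonal -/
def ww (a b : ZMod p) (h : a * b = -1) : SpecialLinearGroup (Fin 2) (ZMod p) :=
  ⟨!![0, a; b, 0], by simp [h]⟩

lemma sq_inj (hp : p % 4 = 3) (x y : R p) (h : x.1 ^ 2 = y.1 ^ 2) : x = y := by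
  rcases sq_eq_sq_iff_eq_or_eq_neg.mp h with h | h
  · exact Subtype.ext h
  · exact absurd h (R_ne_neg hp x y)

lemma M_uu (hp : p % 4 = 3) (b : ZMod p) (x y : R p) :
    M (uu b) x y = if x = y then ps p (b * x.1 ^ 2) else 0 := by
  have hxy : (y.1 = x.1) ↔ x = y := by
    constructor
    · intro h; exact Subtype.ext h.symm
    · rintro rfl; rfl
  have h3 : ¬ (-y.1 = x.1) := fun h => R_ne_neg hp x y h.symm
  simp [M, K, Kf, uu, hxy, h3]

lemma M_tt (hp : p % 4 = 3) (a b : ZMod p) (h : a * b = 1) (ha : IsSquare a) (x y : R p) :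
    M (tt a b h) x y = if y.1 = a * x.1 then 1 else 0 := by
  have ha0 : a ≠ 0 := by rintro rfl; simp at h
  have h3 : ¬ (-y.1 = a * x.1) := fun h =>
    R_ne_neg hp ⟨a * x.1, mul_ne_zero ha0 x.2.1, ha.mul x.2.2⟩ y h.symm
  have h4 : q p a = 1 := by
    simp [q, MulChar.ringHomComp_apply, (quadraticChar_one_iff_isSquare ha0).mpr ha]
  simp [M, K, Kf, tt, h3, h4]

lemma irred (hp : p % 4 = 3) (W : Submodule ℂ (R p → ℂ))
    (hW : ∀ g, ∀ x ∈ W, tau hp g x ∈ W) : W = ⊥ ∨ W = ⊤ := by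
  by_cases hb : W = ⊥
  · exact Or.inl hb
  right
  obtain ⟨f, hf, hf0⟩ := Submodule.exists_mem_ne_zero_of_ne_bot hb
  obtain ⟨x0, hx0⟩ := Function.ne_iff.mp hf0
  have hu : ∀ b : ZMod p, (fun x : R p => ps p (b * x.1 ^ 2) * f x) ∈ W := by
    intro b
    have := hW (QuotientGroup.mk (uu b)) f hf
    rw [tau_mk] at this
    convert this using 1
    ext x
    simp [Matrix.toLin'_apply, Matrix.mulVec, dotProduct, M_uu hp]
  have he : (Pi.single x0 1 : R p → ℂ) ∈ W := by
    have h1 : (∑ b : ZMod p, ps p (- (b * x0.1 ^ 2)) • (fun x : R p => ps p (b * x.1 ^ 2) * f x)) ∈ W :=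
      W.sum_mem fun b _ => W.smul_mem _ (hu b)
    have h2 : (∑ b : ZMod p, ps p (- (b * x0.1 ^ 2)) • (fun x : R p => ps p (b * x.1 ^ 2) * f x)) =
        ((p : ℂ) * f x0) • (Pi.single x0 1 : R p → ℂ) := by
      ext x
      simp only [Finset.sum_apply, Pi.smul_apply, smul_eq_mul]
      have : ∀ b : ZMod p, ps p (- (b * x0.1 ^ 2)) * (ps p (b * x.1 ^ 2) * f x) =
          ps p (b * (x.1 ^ 2 - x0.1 ^ 2)) * f x := by
        intro b
        rw [← mul_assoc, ← ps_add]; congr 2; ring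
      simp only [this, ← Finset.sum_mul, sum_ps_mul, sub_eq_zero]
      by_cases hx : x = x0
      · subst hx; simp
      · rw [if_neg (fun h => hx (sq_inj hp _ _ h))]; simp [hx]
    rw [h2] at h1
    have hne : (p : ℂ) * f x0 ≠ 0 :=
      mul_ne_zero (by exact_mod_cast (Fact.out : p.Prime).ne_zero) hx0
    exact (W.smul_mem_iff hne).mp h1
  have hall : ∀ x1 : R p, (Pi.single x1 1 : R p → ℂ) ∈ W := by
    intro x1
    have hx1 := x1.2.1
    have hx0 := x0.2.1
    have hab : (x0.1 / x1.1) * (x1.1 / x0.1) = 1 := by field_simp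
    have := hW (QuotientGroup.mk (tt _ _ hab)) _ he
    rw [tau_mk] at this
    convert this using 1
    ext x
    simp only [Matrix.toLin'_apply, Matrix.mulVec_single_one, Matrix.col_apply]
    rw [M_tt hp _ _ _ (x0.2.2.div x1.2.2)]
    by_cases hx : x = x1
    · subst hx; simp [x.2.1]
    · rw [if_neg]
      · simp [hx]
      · intro h
        apply hx
        apply Subtype.ext
        field_simp at h
        exact h.symm
  rw [eq_top_iff]
  intro f _
  rw [pi_eq_sum_univ' f]
  exact W.sum_mem fun x _ => W.smul_mem _ (by
    convert hall x using 1)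

/-- The character. -/
noncomputable def chi (hp : p % 4 = 3) (g : ProjectiveSpecialLinearGroup (Fin 2) (ZMod p)) : ℂ :=
  LinearMap.trace ℂ _ (tau hp g)

instance : Nonempty (R p) := ⟨⟨1, one_ne_zero, IsSquare.one⟩⟩

lemma chi_irr (hp : p % 4 = 3) : IsIrrChar _ (chi hp) :=
  ⟨R p → ℂ, inferInstance, inferInstance, inferInstance, tau hp, inferInstance,
    irred hp, fun _ => rfl⟩

lemma chi_mk (hp : p % 4 = 3) (g : SpecialLinearGroup (Fin 2) (ZMod p)) :
    chi hp (QuotientGroup.mk g) = ∑ x : R p, (K g x.1 x.1 - K g x.1 (-x.1)) := by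
  rw [chi, tau_mk, Matrix.trace_toLin'_eq]
  rfl

lemma card_R (hp : p % 4 = 3) : (Fintype.card (R p) : ℂ) = ((p : ℂ) - 1) / 2 := by
  have := sum_half hp (fun _ => 1)
  simp at this
  rw [this]; ring

lemma chi_one (hp : p % 4 = 3) : chi hp 1 = ((p : ℂ) - 1) / 2 := by
  rw [chi, map_one, ← card_R hp]
  simp

lemma chi_tt (hp : p % 4 = 3) (a b : ZMod p) (h : a * b = 1) (h1 : a ≠ 1) (h2 : a ≠ -1) :
    chi hp (QuotientGroup.mk (tt a b h)) = 0 := by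
  rw [chi_mk]
  refine Finset.sum_eq_zero fun x _ => ?_
  have hx := x.2.1
  have e1 : ¬ (x.1 = a * x.1) := by
    intro h; apply h1
    exact (mul_right_cancel₀ hx (by rw [← h, one_mul]))
  have e2 : ¬ (-x.1 = a * x.1) := by
    intro h; apply h2
    exact (mul_right_cancel₀ hx (by rw [← h]; ring))
  simp [K, Kf, tt, e1, e2]

lemma chi_uu (hp : p % 4 = 3) : 2 * chi hp (QuotientGroup.mk (uu 1)) + 1 = gs p := by
  have h0 := sum_half hp (fun z => ps p (z ^ 2))
  rw [chi_mk]
  change gs p = _ at h0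
  rw [h0, Finset.mul_sum, add_comm]
  congr 1
  · simp
  · refine Finset.sum_congr rfl fun x _ => ?_
    have h3 : ¬ (-x.1 = x.1) := fun h => R_ne_neg hp x x h.symm
    simp [K, Kf, uu, h3]; ring

lemma chi_nonreal (hp : p % 4 = 3) : chi hp ≠ fun g => (starRingEnd ℂ) (chi hp g) := by
  intro h
  have h1 := congrFun h (QuotientGroup.mk (uu 1))
  have h2 := chi_uu hp
  have h3 : (starRingEnd ℂ) (gs p) = gs p := by
    rw [← h2]; simp only [map_add, map_mul, map_one, map_ofNat, ← h1]
  obtain ⟨r, hr⟩ := Complex.conj_eq_iff_real.mp h3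
  have h4 := gs_sq hp
  rw [hr] at h4
  have h5 : r * r = - (p : ℝ) := by exact_mod_cast h4
  have h6 : (0 : ℝ) < p := by exact_mod_cast (Fact.out : p.Prime).pos
  nlinarith

/-- the value on involutions -/
noncomputable def eps (p : ℕ) [Fact p.Prime] : ℂ := q p (-2)

lemma chi_ww (hp : p % 4 = 3) (a b : ZMod p) (h : a * b = -1) :
    chi hp (QuotientGroup.mk (ww a b h)) = eps p := by
  have hb : b ≠ 0 := by rintro rfl; simp at h
  have h2 := two_ne hp
  have hA : (-2) / b ≠ 0 := div_ne_zero (neg_ne_zero.mpr h2) hb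
  have hB : 2 / b ≠ 0 := div_ne_zero h2 hb
  have s1 := sum_ps_sq hp hA
  have s2 := sum_ps_sq hp hB
  rw [← gs_eq hp, sum_half hp] at s1 s2
  have hq : q p (2 / b) = - q p (-2 / b) := by
    rw [show 2 / b = (-1) * (-2 / b) by ring, q_mul, q_neg_one hp]; ring
  rw [hq] at s2
  rw [chi_mk]
  have hK : ∀ x : R p, K (ww a b h) x.1 x.1 - K (ww a b h) x.1 (-x.1) =
      (gs p)⁻¹ * q p b * (ps p (-2 / b * x.1 ^ 2) - ps p (2 / b * x.1 ^ 2)) := by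
    intro x
    simp only [K, Kf, ww]
    simp [hb]
    rw [mul_sub]
    congr 3 <;> ring
  rw [Finset.sum_congr rfl fun x _ => hK x, ← Finset.mul_sum, Finset.sum_sub_distrib]
  have s3 : ∑ x : R p, ps p (-2 / b * x.1 ^ 2) - ∑ x : R p, ps p (2 / b * x.1 ^ 2) =
      q p (-2 / b) * gs p := by
    simp only [neg_sq, ← two_mul, ← Finset.mul_sum] at s1 s2
    have z1 : ps p (-2 / b * 0 ^ 2) = 1 := by simp
    have z2 : ps p (2 / b * 0 ^ 2) = 1 := by simp
    rw [z1] at s1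
    rw [z2] at s2
    linear_combination (s1 - s2) / 2
  rw [s3, eps, div_eq_mul_inv, q_mul, q_inv]
  have e1 := q_sq hb
  have e3 : (gs p)⁻¹ * gs p = 1 := inv_mul_cancel₀ (gs_ne hp)
  linear_combination q p (-2) * (q p b * q p b) * e3 + q p (-2) * e1

lemma eps_pm (hp : p % 4 = 3) : eps p = 1 ∨ eps p = -1 :=
  q_dich (neg_ne_zero.mpr (two_ne hp))

end Weil


namespace Weil

lemma frob {G : Type} [Group G] [Fintype G] (H : Subgroup G) [Fintype H] (χ : G → ℂ)
    (hχ : ∀ g h, χ (g * h * g⁻¹) = χ h) :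
    ipCF' (fun g => (Nat.card {x : G ⧸ H // g • x = x} : ℂ)) χ =
      (Nat.card H : ℂ)⁻¹ * ∑ h : H, (starRingEnd ℂ) (χ h) := by
  classical
  have key : ∀ x : G ⧸ H, (∑ g : G, if g • x = x then (starRingEnd ℂ) (χ g) else 0) =
      ∑ h : H, (starRingEnd ℂ) (χ h) := by
    intro x
    induction x using QuotientGroup.induction_on with
    | H k =>
    have h1 : ∑ h : H, (starRingEnd ℂ) (χ h) =
        ∑ g : G, if g ∈ H then (starRingEnd ℂ) (χ g) else 0 := by
      rw [← Finset.sum_filter]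
      symm
      apply Finset.sum_subtype
      intro x; simp
    rw [h1]
    symm
    refine Fintype.sum_equiv (MulAut.conj k).toEquiv _ _ fun g => ?_
    have h2 : (MulAut.conj k).toEquiv g = k * g * k⁻¹ := rfl
    rw [h2, hχ]
    have h3 : (k * g * k⁻¹) • (QuotientGroup.mk k : G ⧸ H) = QuotientGroup.mk (k * g) := by
      rw [MulAction.Quotient.smul_mk]; congr 1; simp
    rw [h3]
    have h4 : ((QuotientGroup.mk (k * g) : G ⧸ H) = QuotientGroup.mk k) ↔ g ∈ H := by
      rw [eq_comm, QuotientGroup.eq]; simp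
    simp only [h4]
  rw [ipCF', finsum_eq_sum_of_fintype]
  have h5 : ∀ g : G, (Nat.card {x : G ⧸ H // g • x = x} : ℂ) * (starRingEnd ℂ) (χ g) =
      ∑ x : G ⧸ H, if g • x = x then (starRingEnd ℂ) (χ g) else 0 := by
    intro g
    rw [← Finset.sum_filter, Finset.sum_const, nsmul_eq_mul, Nat.card_eq_fintype_card,
      Fintype.card_subtype]
  simp only [h5]
  rw [Finset.sum_comm]
  simp only [key]
  rw [Finset.sum_const, nsmul_eq_mul, ← mul_assoc]
  congr 1
  have h6 := H.card_eq_card_quotient_mul_card_subgroup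
  have h7 : (Finset.univ : Finset (G ⧸ H)).card = Nat.card (G ⧸ H) := by
    rw [Nat.card_eq_fintype_card]; rfl
  rw [h7, h6]
  have : (Nat.card (G ⧸ H) : ℂ) ≠ 0 := by exact_mod_cast Nat.card_pos.ne'
  have : (Nat.card H : ℂ) ≠ 0 := by exact_mod_cast Nat.card_pos.ne'
  push_cast
  field_simp

/-- The dihedral homomorphism attached to two involutions. -/
def dih {G : Type} [Group G] (n : ℕ) [NeZero n] (s t : G) (hs : s ^ 2 = 1) (ht : t ^ 2 = 1)
    (hr : (s * t) ^ n = 1) : DihedralGroup n →* G where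
  toFun d := match d with
    | .r i => (s * t) ^ i.val
    | .sr i => s * (s * t) ^ i.val
  map_one' := by
    change (s * t) ^ (0 : ZMod n).val = 1
    simp
  map_mul' := by
    have hs' : s * s = 1 := by rw [← sq, hs]
    have ht' : t * t = 1 := by rw [← sq, ht]
    have e1 : ∀ i j : ZMod n, (s * t) ^ (i + j).val = (s * t) ^ i.val * (s * t) ^ j.val := by
      intro i j
      rw [← pow_add, ZMod.val_add, ← pow_mod_orderOf, Nat.mod_mod_of_dvd _ (orderOf_dvd_of_pow_eq_one hr),
        pow_mod_orderOf]
    have e2 : ∀ k : ℕ, (s * t) ^ k * s * (s * t) ^ k = s := by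
      intro k
      induction k with
      | zero => simp
      | succ k ih =>
        nth_rewrite 2 [pow_succ' (s * t) k]
        rw [pow_succ (s * t)]
        calc (s * t) ^ k * (s * t) * s * (s * t * (s * t) ^ k)
            = (s * t) ^ k * s * (t * (s * s) * t) * (s * t) ^ k := by simp only [mul_assoc]
          _ = s := by rw [hs', mul_one, ht', mul_one, ih]
    have e3 : ∀ i j : ZMod n, (s * t) ^ i.val * s * (s * t) ^ j.val = s * (s * t) ^ (j - i).val := by
      intro i j
      have : j = i + (j - i) := by ring
      conv_lhs => rw [this, e1, ← mul_assoc, e2]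
    rintro (i | i) (j | j)
    · exact e1 i j
    · rw [DihedralGroup.r_mul_sr]
      change s * (s * t) ^ (j - i).val = (s * t) ^ i.val * (s * (s * t) ^ j.val)
      rw [← mul_assoc, e3]
    · rw [DihedralGroup.sr_mul_r]
      change s * (s * t) ^ (i + j).val = s * (s * t) ^ i.val * ((s * t) ^ j.val)
      rw [e1, mul_assoc]
    · rw [DihedralGroup.sr_mul_sr]
      change (s * t) ^ (j - i).val = s * (s * t) ^ i.val * (s * (s * t) ^ j.val)
      rw [mul_assoc, ← mul_assoc ((s * t) ^ i.val), e3, ← mul_assoc, hs', one_mul]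

lemma dih_range {G : Type} [Group G] (n : ℕ) [NeZero n] (hn : 1 < n) (s t : G) (hs : s ^ 2 = 1)
    (ht : t ^ 2 = 1) (hr : (s * t) ^ n = 1) :
    (dih n s t hs ht hr).range = Subgroup.closure {s, t} := by
  have hs' : s * s = 1 := by rw [← sq, hs]
  have ms : s ∈ Subgroup.closure {s, t} := Subgroup.subset_closure (by simp)
  have mt : t ∈ Subgroup.closure {s, t} := Subgroup.subset_closure (by simp)
  apply le_antisymm
  · rintro _ ⟨(i | i), rfl⟩
    · exact pow_mem (mul_mem ms mt) _
    · exact mul_mem ms (pow_mem (mul_mem ms mt) _)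
  · rw [Subgroup.closure_le]
    rintro x hx
    rcases hx with rfl | rfl
    · refine ⟨.sr 0, ?_⟩
      change x * (x * t) ^ (0 : ZMod n).val = x
      simp
    · refine ⟨.sr 1, ?_⟩
      change s * (s * x) ^ (1 : ZMod n).val = x
      have : Fact (1 < n) := ⟨hn⟩
      rw [ZMod.val_one, pow_one, ← mul_assoc, hs', one_mul]

end Weil


namespace Weil
variable {p : ℕ} [Fact p.Prime]

lemma mk_eq_iff (g h : SpecialLinearGroup (Fin 2) (ZMod p)) :
    (QuotientGroup.mk g : ProjectiveSpecialLinearGroup (Fin 2) (ZMod p)) = QuotientGroup.mk h ↔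
      g = h ∨ g = -h := by
  rw [QuotientGroup.eq]
  constructor
  · intro hc
    rcases center_pm hc with hc | hc
    · left; exact (inv_mul_eq_one.mp hc)
    · right
      have : h = g * (-1) := by rw [← hc]; simp
      rw [this]; simp
  · intro hc
    apply mem_center_pm
    rcases hc with rfl | rfl
    · simp
    · right
      rw [inv_mul_eq_iff_eq_mul]; simp

/-- abbreviation for the projection -/
abbrev pr (g : SpecialLinearGroup (Fin 2) (ZMod p)) :
    ProjectiveSpecialLinearGroup (Fin 2) (ZMod p) := QuotientGroup.mk g

lemma pr_mul (g h : SpecialLinearGroup (Fin 2) (ZMod p)) : pr (g * h) = pr g * pr h := rfl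
lemma pr_neg (g : SpecialLinearGroup (Fin 2) (ZMod p)) : pr (-g) = pr g :=
  (mk_eq_iff _ _).mpr (Or.inr rfl)

/-- the third generator -/
def S2 (x y : ZMod p) (h : x ^ 2 + y ^ 2 = -1) : SpecialLinearGroup (Fin 2) (ZMod p) :=
  ⟨!![x, y; y, -x], by simp only [Matrix.det_fin_two_of]; linear_combination -h⟩

lemma ext2 {g h : SpecialLinearGroup (Fin 2) (ZMod p)} (h1 : g 0 0 = h 0 0) (h2 : g 0 1 = h 0 1)
    (h3 : g 1 0 = h 1 0) (h4 : g 1 1 = h 1 1) : g = h := by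
  ext i j
  fin_cases i <;> fin_cases j <;> assumption

lemma mul_e (g h : SpecialLinearGroup (Fin 2) (ZMod p)) (i j : Fin 2) :
    (g * h) i j = g i 0 * h 0 j + g i 1 * h 1 j := by
  simp [Matrix.mul_apply, Fin.sum_univ_two]

lemma neg_e (g : SpecialLinearGroup (Fin 2) (ZMod p)) (i j : Fin 2) : (-g) i j = - g i j := by
  simp

lemma tt_mul (a b c d : ZMod p) (h : a * b = 1) (h' : c * d = 1) (h'' : (a * c) * (b * d) = 1) :
    tt a b h * tt c d h' = tt (a * c) (b * d) h'' := by
  apply ext2 <;> rw [mul_e] <;> simp [tt]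

lemma tt_pow (a b : ZMod p) (h : a * b = 1) (n : ℕ) :
    tt a b h ^ n = tt (a ^ n) (b ^ n) (by rw [← mul_pow, h, one_pow]) := by
  induction n with
  | zero => rw [pow_zero]; apply ext2 <;> simp [tt]
  | succ n ih =>
    rw [pow_succ, ih, tt_mul]
    · congr 1 <;> rw [pow_succ]
    · rw [← pow_succ, ← pow_succ, ← mul_pow, h, one_pow]

lemma S0_mul_tt (a b : ZMod p) (h : a * b = 1) :
    ww 1 (-1) (by ring) * tt a b h = ww b (-a) (by linear_combination -h) := by
  apply ext2 <;> rw [mul_e] <;> simp [tt, ww]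

section
variable (hp : p % 4 = 3) (z w : ZMod p) (hzw : z * w = 1)

/-- first generator -/
def s0 (p : ℕ) [Fact p.Prime] : ProjectiveSpecialLinearGroup (Fin 2) (ZMod p) :=
  pr (ww 1 (-1) (by ring))

/-- second generator -/
def s1 : ProjectiveSpecialLinearGroup (Fin 2) (ZMod p) :=
  pr (ww z (-w) (by linear_combination -hzw))

lemma ww_sq (a b : ZMod p) (h : a * b = -1) : pr (ww a b h) ^ 2 = 1 := by
  rw [sq, ← pr_mul]
  change _ = pr 1
  rw [← pr_neg]
  congr 1
  have h' : b * a = -1 := by rw [mul_comm, h]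
  apply ext2 <;> rw [neg_e, mul_e] <;> simp [ww, h, h']

lemma ww_ne (a b : ZMod p) (h : a * b = -1) : pr (ww a b h) ≠ 1 := by
  change _ ≠ pr 1
  intro he
  rcases (mk_eq_iff _ _).mp he with he | he
  · have := congrArg (fun g : SpecialLinearGroup (Fin 2) (ZMod p) => g 0 0) he
    simp [ww] at this
  · have := congrArg (fun g : SpecialLinearGroup (Fin 2) (ZMod p) => g 0 0) he
    simp [ww] at this

lemma S2_sq (x y : ZMod p) (h : x ^ 2 + y ^ 2 = -1) : pr (S2 x y h) ^ 2 = 1 := by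
  rw [sq, ← pr_mul]
  change _ = pr 1
  rw [← pr_neg]
  congr 1
  apply ext2 <;> rw [neg_e, mul_e] <;> simp [S2] <;>
    first | ring1 | linear_combination -h

lemma S2_ne (x y : ZMod p) (h : x ^ 2 + y ^ 2 = -1) (hy : y ≠ 0) : pr (S2 x y h) ≠ 1 := by
  change _ ≠ pr 1
  intro he
  rcases (mk_eq_iff _ _).mp he with he | he
  · have := congrArg (fun g : SpecialLinearGroup (Fin 2) (ZMod p) => g 0 1) he
    simp [S2, hy] at this
  · have := congrArg (fun g : SpecialLinearGroup (Fin 2) (ZMod p) => g 0 1) he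
    simp [S2, hy] at this

lemma s0_s2 (x y : ZMod p) (h : x ^ 2 + y ^ 2 = -1) :
    s0 p * pr (S2 x y h) = pr (S2 x y h) * s0 p := by
  unfold s0
  rw [← pr_mul, ← pr_mul, ← pr_neg]
  congr 1
  apply ext2 <;> rw [neg_e, mul_e, mul_e] <;> simp [S2, ww]

lemma s0_mul_s1 : s0 p * s1 z w hzw = pr (tt w z (by rw [mul_comm, hzw])) := by
  unfold s0 s1
  rw [← pr_mul, ← pr_neg]
  congr 1
  apply ext2 <;> rw [neg_e, mul_e] <;> simp [ww, tt]

lemma s01_pow (n : ℕ) : (s0 p * s1 z w hzw) ^ n =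
    pr (tt (w ^ n) (z ^ n) (by rw [← mul_pow, mul_comm w, hzw, one_pow])) := by
  rw [s0_mul_s1]
  change pr (_ ^ n) = _
  rw [tt_pow]

lemma s0_s01_pow (n : ℕ) : s0 p * (s0 p * s1 z w hzw) ^ n =
    pr (ww (z ^ n) (-(w ^ n)) (by rw [mul_neg, ← mul_pow, hzw, one_pow])) := by
  rw [s01_pow]
  unfold s0
  rw [← pr_mul, S0_mul_tt]

lemma tt_pr_one (a b : ZMod p) (h : a * b = 1) : pr (tt a b h) = 1 ↔ a = 1 ∨ a = -1 := by
  change pr _ = pr 1 ↔ _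
  rw [mk_eq_iff]
  constructor
  · rintro (he | he)
    · left
      have := congrArg (fun g : SpecialLinearGroup (Fin 2) (ZMod p) => g 0 0) he
      simpa [tt] using this
    · right
      have := congrArg (fun g : SpecialLinearGroup (Fin 2) (ZMod p) => g 0 0) he
      simpa [tt] using this
  · rintro (rfl | rfl)
    · left
      have hb : b = 1 := by simpa using h
      subst hb
      apply ext2 <;> simp [tt]
    · right
      have hb : b = -1 := by linear_combination -h
      subst hb
      apply ext2 <;> simp [tt]

variable (hz7 : z ^ 7 = 1) (hz1 : z ≠ 1)
include hp hzw hz7 hz1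

lemma w7 : w ^ 7 = 1 := by
  have : (z * w) ^ 7 = 1 := by rw [hzw, one_pow]
  rwa [mul_pow, hz7, one_mul] at this

lemma w_pow (i : ℕ) (hi : i < 7) (h0 : i ≠ 0) : w ^ i ≠ 1 ∧ w ^ i ≠ -1 := by
  have h7 := w7 hp z w hzw hz7 hz1
  have hw1 : w ≠ 1 := by
    rintro rfl
    exact hz1 (by simpa using hzw)
  have ho : orderOf w = 7 := by
    have : Fact (Nat.Prime 7) := ⟨by norm_num⟩
    exact orderOf_eq_prime h7 hw1
  constructor
  · intro h
    have := orderOf_dvd_of_pow_eq_one h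
    rw [ho] at this
    omega
  · intro h
    have h1 : (w ^ i) ^ 7 = 1 := by rw [← pow_mul, mul_comm, pow_mul, h7, one_pow]
    rw [h] at h1
    apply two_ne hp
    linear_combination -h1

lemma s01_7 : (s0 p * s1 z w hzw) ^ 7 = 1 := by
  rw [s01_pow, tt_pr_one]
  exact Or.inl (w7 hp z w hzw hz7 hz1)

/-- dihedral hom -/
def dh : DihedralGroup 7 →* ProjectiveSpecialLinearGroup (Fin 2) (ZMod p) :=
  dih 7 (s0 p) (s1 z w hzw) (ww_sq _ _ _) (ww_sq _ _ _) (s01_7 hp z w hzw hz7 hz1)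

lemma dh_r (i : ZMod 7) : dh hp z w hzw hz7 hz1 (.r i) =
    pr (tt (w ^ i.val) (z ^ i.val) (by rw [← mul_pow, mul_comm w, hzw, one_pow])) :=
  s01_pow z w hzw i.val

lemma dh_sr (i : ZMod 7) : dh hp z w hzw hz7 hz1 (.sr i) =
    pr (ww (z ^ i.val) (-(w ^ i.val)) (by rw [mul_neg, ← mul_pow, hzw, one_pow])) :=
  s0_s01_pow z w hzw i.val

lemma dh_inj : Function.Injective (dh hp z w hzw hz7 hz1) := by
  rw [injective_iff_map_eq_one]
  rintro (i | i) h
  · rw [dh_r, tt_pr_one] at h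
    by_cases h0 : i.val = 0
    · rw [ZMod.val_eq_zero] at h0
      rw [h0]; rfl
    · have := w_pow hp z w hzw hz7 hz1 i.val (ZMod.val_lt i) h0
      tauto
  · rw [dh_sr] at h
    exact absurd h (ww_ne _ _ _)

lemma dh_range : (dh hp z w hzw hz7 hz1).range = Subgroup.closure {s0 p, s1 z w hzw} :=
  dih_range 7 (by norm_num) _ _ _ _ _

/-- equivalence -/
noncomputable def dhEquiv : DihedralGroup 7 ≃* Subgroup.closure {s0 p, s1 z w hzw} :=
  (MonoidHom.ofInjective (dh_inj hp z w hzw hz7 hz1)).trans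
    (MulEquiv.subgroupCongr (dh_range hp z w hzw hz7 hz1))

lemma dhEquiv_coe (d : DihedralGroup 7) :
    ((dhEquiv hp z w hzw hz7 hz1 d : Subgroup.closure {s0 p, s1 z w hzw}) :
      ProjectiveSpecialLinearGroup (Fin 2) (ZMod p)) = dh hp z w hzw hz7 hz1 d := rfl

lemma cardH : Nat.card (Subgroup.closure {s0 p, s1 z w hzw}) = 14 := by
  rw [← Nat.card_congr (dhEquiv hp z w hzw hz7 hz1).toEquiv, DihedralGroup.nat_card]

lemma sumH [Fintype (Subgroup.closure {s0 p, s1 z w hzw})] :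
    ∑ h : Subgroup.closure {s0 p, s1 z w hzw}, (starRingEnd ℂ) (chi hp h) =
      ((p : ℂ) - 1) / 2 + 7 * eps p := by
  rw [← (dhEquiv hp z w hzw hz7 hz1).toEquiv.sum_comp]
  let e : ZMod 7 ⊕ ZMod 7 ≃ DihedralGroup 7 :=
    { toFun := Sum.elim .r .sr
      invFun := fun d => match d with
        | .r i => .inl i
        | .sr i => .inr i
      left_inv := by rintro (i | i) <;> rfl
      right_inv := by rintro (i | i) <;> rfl }
  rw [← e.sum_comp, Fintype.sum_sum_type]
  have h1 : ∀ i : ZMod 7, (starRingEnd ℂ) (chi hp ((dhEquiv hp z w hzw hz7 hz1).toEquiv (e (.inl i))).1) =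
      if i = 0 then ((p : ℂ) - 1) / 2 else 0 := by
    intro i
    change (starRingEnd ℂ) (chi hp (dh hp z w hzw hz7 hz1 (.r i))) = _
    split_ifs with h
    · subst h
      have : dh hp z w hzw hz7 hz1 (.r 0) = 1 := map_one _
      rw [this, chi_one]
      simp [Complex.conj_ofNat]
    · rw [dh_r]
      have := w_pow hp z w hzw hz7 hz1 i.val (ZMod.val_lt i) (by rwa [Ne, ZMod.val_eq_zero])
      rw [chi_tt hp _ _ _ this.1 this.2, map_zero]
  have h2 : ∀ i : ZMod 7, (starRingEnd ℂ) (chi hp ((dhEquiv hp z w hzw hz7 hz1).toEquiv (e (.inr i))).1) =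
      eps p := by
    intro i
    change (starRingEnd ℂ) (chi hp (dh hp z w hzw hz7 hz1 (.sr i))) = _
    rw [dh_sr, chi_ww]
    rcases eps_pm hp with h | h <;> rw [h] <;> simp
  rw [Finset.sum_congr rfl fun i _ => h1 i, Finset.sum_congr rfl fun i _ => h2 i]
  simp

end
end Weil


namespace Weil
variable {p : ℕ} [Fact p.Prime]

lemma dihedral_comm {G : Type} [Group G] (s t : G) (hs : s ^ 2 = 1) (ht : t ^ 2 = 1) (l : G)
    (hl : l ∈ Subgroup.closure {s, t}) : l ^ 2 * (s * t) = (s * t) * l ^ 2 := by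
  have hs' : s⁻¹ = s := by rw [inv_eq_iff_mul_eq_one, ← sq, hs]
  have ht' : t⁻¹ = t := by rw [inv_eq_iff_mul_eq_one, ← sq, ht]
  have key : l * (s * t) * l⁻¹ = s * t ∨ l * (s * t) * l⁻¹ = (s * t)⁻¹ := by
    induction hl using Subgroup.closure_induction with
    | mem x hx =>
      right
      rcases hx with rfl | rfl
      · rw [_root_.mul_inv_rev, hs', ht', ← mul_assoc, ← sq, hs, one_mul]
      · rw [_root_.mul_inv_rev, hs', ht']
        rw [mul_assoc, mul_assoc, ← sq, ht, mul_one]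
    | one => simp
    | mul a b _ _ ha hb =>
      have e : a * b * (s * t) * (a * b)⁻¹ = a * (b * (s * t) * b⁻¹) * a⁻¹ := by group
      rw [e]
      have e2 : a * (s * t)⁻¹ * a⁻¹ = (a * (s * t) * a⁻¹)⁻¹ := by group
      rcases hb with hb | hb <;> rw [hb]
      · exact ha
      · rw [e2]
        rcases ha with ha | ha <;> rw [ha] <;> simp
    | inv a _ ha =>
      rcases ha with ha | ha
      · left
        conv_lhs => rw [← ha]
        group
      · right
        have : (s * t)⁻¹ = a⁻¹ * (a * (s * t) * a⁻¹)⁻¹ * a := by group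
        rw [this, ha]; group
  have e : l ^ 2 * (s * t) * (l ^ 2)⁻¹ = s * t := by
    have e1 : l ^ 2 * (s * t) * (l ^ 2)⁻¹ = l * (l * (s * t) * l⁻¹) * l⁻¹ := by
      rw [sq]; group
    have e2 : l * (s * t)⁻¹ * l⁻¹ = (l * (s * t) * l⁻¹)⁻¹ := by group
    rw [e1]
    rcases key with h | h
    · rw [h, h]
    · rw [h, e2, h, inv_inv]
  exact mul_inv_eq_iff_eq_mul.mp e

lemma rot_not_mem (hp : p % 4 = 3) (z w : ZMod p) (hzw : z * w = 1) (c d : ZMod p)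
    (hcd : c * d = 1) (h7 : c ^ 7 = 1) (x y : ZMod p) (hxy : x ^ 2 + y ^ 2 = -1)
    (hx : x ≠ 0) (hy : y ≠ 0)
    (hm : pr (tt c d hcd) ∈ Subgroup.closure {s1 z w hzw, pr (S2 x y hxy)}) : c = 1 := by
  have h := dihedral_comm _ _ (ww_sq _ _ _) (S2_sq x y hxy) _ hm
  have hab : c ^ 2 * d ^ 2 = 1 := by rw [← mul_pow, hcd, one_pow]
  have hba : d ^ 2 * c ^ 2 = 1 := by rw [mul_comm, hab]
  have hl : pr (tt c d hcd) ^ 2 = pr (tt (c ^ 2) (d ^ 2) hab) := by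
    change pr (_ ^ 2) = _
    rw [tt_pow]
  rw [hl] at h
  set D := tt (c ^ 2) (d ^ 2) hab with hD
  have h1 : pr D * s1 z w hzw * pr D = s1 z w hzw := by
    unfold s1
    rw [← pr_mul, ← pr_mul]
    congr 1
    apply ext2 <;> simp only [mul_e] <;> simp [hD, tt, ww]
    · linear_combination z * hab
    · linear_combination w * hab
  have h2 : pr D * pr (S2 x y hxy) * pr D = pr (S2 x y hxy) := by
    have e1 : pr D * s1 z w hzw = s1 z w hzw * (pr D)⁻¹ := eq_mul_inv_of_mul_eq h1
    change pr D * (s1 z w hzw * _) = _ at h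
    rw [← mul_assoc, e1, mul_assoc, mul_assoc] at h
    have e2 := mul_left_cancel h
    rw [inv_mul_eq_iff_eq_mul] at e2
    rw [mul_assoc]; exact e2.symm
  rw [← pr_mul, ← pr_mul] at h2
  have hc4 : c ^ 4 = 1 := by
    rcases (mk_eq_iff _ _).mp h2 with he | he
    · have := congrArg (fun g : SpecialLinearGroup (Fin 2) (ZMod p) => g 0 0) he
      simp only [mul_e] at this
      simp [S2, hD, tt] at this
      have h3 : (c ^ 4 - 1) * x = 0 := by linear_combination this
      rcases mul_eq_zero.mp h3 with h3 | h3
      · linear_combination h3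
      · exact absurd h3 hx
    · have := congrArg (fun g : SpecialLinearGroup (Fin 2) (ZMod p) => g 0 1) he
      simp only [mul_e, neg_e] at this
      simp [S2, hD, tt] at this
      have h3 : 2 * y = 0 := by linear_combination this - y * hab
      rcases mul_eq_zero.mp h3 with h3 | h3
      · exact absurd h3 (two_ne hp)
      · exact absurd h3 hy
  linear_combination (c ^ 4 + 1) * hc4 - c * h7

lemma intersect (hp : p % 4 = 3) (z w : ZMod p) (hzw : z * w = 1)
    (hz7 : z ^ 7 = 1) (hz1 : z ≠ 1) (x y : ZMod p) (hxy : x ^ 2 + y ^ 2 = -1)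
    (hx : x ≠ 0) (hy : y ≠ 0) :
    Subgroup.closure {s0 p, s1 z w hzw} ⊓ Subgroup.closure {s1 z w hzw, pr (S2 x y hxy)}
      = Subgroup.closure {s1 z w hzw} := by
  have key : ∀ i : ZMod 7, dh hp z w hzw hz7 hz1 (.r i) ∈
      Subgroup.closure {s1 z w hzw, pr (S2 x y hxy)} → i = 0 := by
    intro i hi
    rw [dh_r] at hi
    by_contra h0
    have h1 := w_pow hp z w hzw hz7 hz1 i.val (ZMod.val_lt i) (by rwa [Ne, ZMod.val_eq_zero])
    apply h1.1
    refine rot_not_mem hp z w hzw _ _ _ ?_ x y hxy hx hy hi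
    rw [← pow_mul, mul_comm, pow_mul, w7 hp z w hzw hz7 hz1, one_pow]
  have m1 : s1 z w hzw ∈ Subgroup.closure {s1 z w hzw, pr (S2 x y hxy)} :=
    Subgroup.subset_closure (by simp)
  have hs1 : dh hp z w hzw hz7 hz1 (.sr 1) = s1 z w hzw := by
    rw [dh_sr]
    have : (1 : ZMod 7).val = 1 := rfl
    simp only [this, pow_one]
    rfl
  apply le_antisymm
  · rintro g ⟨hg, hl⟩
    have hg' : g ∈ (dh hp z w hzw hz7 hz1).range := by rw [dh_range]; exact hg
    obtain ⟨d, rfl⟩ := hg'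
    rcases d with i | i
    · have := key i hl
      subst this
      have : dh hp z w hzw hz7 hz1 (.r 0) = 1 := map_one _
      rw [this]; exact one_mem _
    · have h1 := mul_mem hl m1
      rw [← hs1, ← map_mul, DihedralGroup.sr_mul_sr, hs1] at h1
      have h2 := key _ h1
      have h3 : i = 1 := (sub_eq_zero.mp h2).symm
      rw [h3, hs1]
      exact Subgroup.subset_closure (by simp)
  · rw [Subgroup.closure_le]
    rintro _ rfl
    exact ⟨Subgroup.subset_closure (by simp), m1⟩

end Weil


namespace Weil
variable {p : ℕ} [Fact p.Prime]

lemma uu_pow (b : ZMod p) (n : ℕ) : uu b ^ n = uu ((n : ZMod p) * b) := by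
  induction n with
  | zero => rw [pow_zero]; apply ext2 <;> simp [uu]
  | succ n ih =>
    rw [pow_succ, ih]
    apply ext2 <;> rw [mul_e] <;> simp [uu]
    ring

lemma gen1 (Kt : Subgroup (SpecialLinearGroup (Fin 2) (ZMod p))) (b : ZMod p) (hb : b ≠ 0)
    (hu : uu b ∈ Kt) (h : SpecialLinearGroup (Fin 2) (ZMod p)) (hh : h ∈ Kt) (hc : h 1 0 ≠ 0) :
    Kt = ⊤ := by
  have hU : ∀ b', uu b' ∈ Kt := by
    intro b'
    have := pow_mem hu (b' / b).val
    rw [uu_pow, ZMod.natCast_zmod_val, div_mul_cancel₀ _ hb] at this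
    exact this
  have hd := det_eq h
  set c := h 1 0 with hcc
  have hab : (-c⁻¹) * c = -1 := by field_simp
  have hW : ww (-c⁻¹) c hab ∈ Kt := by
    have := mul_mem (mul_mem (hU (-(h 0 0) / c)) hh) (hU (-(h 1 1) / c))
    convert this using 1
    apply ext2 <;> simp only [mul_e] <;> simp [uu, ww, ← hcc] <;> field_simp
    · ring
    · linear_combination hd
    · ring
  have hL : ∀ e, ll e ∈ Kt := by
    intro e
    have := mul_mem (mul_mem hW (hU (-e / c ^ 2))) (inv_mem hW)
    convert this using 1
    rw [eq_mul_inv_iff_mul_eq]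
    apply ext2 <;> simp only [mul_e] <;> simp [uu, ww, ll]
    field_simp
  have hG : ∀ g : SpecialLinearGroup (Fin 2) (ZMod p), g 1 0 ≠ 0 → g ∈ Kt := by
    intro g hg
    have hd := det_eq g
    have := mul_mem (mul_mem (hU ((g 0 0 - 1) / g 1 0)) (hL (g 1 0))) (hU ((g 1 1 - 1) / g 1 0))
    convert this using 1
    apply ext2 <;> simp only [mul_e] <;> simp [uu, ll] <;> field_simp
    · ring
    · linear_combination -hd
    · ring
  rw [eq_top_iff]
  intro g _
  by_cases hg : g 1 0 = 0
  · have hd := det_eq g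
    have h1 : ll 1 * g ∈ Kt := by
      apply hG
      rw [mul_e]
      simp [ll, hg]
      intro h0
      rw [hg, h0] at hd
      simp at hd
    exact (Subgroup.mul_mem_cancel_left _ (hL 1)).mp h1
  · exact hG g hg

lemma gen2 (hp : p % 4 = 3) (Kt : Subgroup (SpecialLinearGroup (Fin 2) (ZMod p)))
    (h0 : ww 1 (-1) (by ring) ∈ Kt) (g : SpecialLinearGroup (Fin 2) (ZMod p)) (hg : g ∈ Kt)
    (hg1 : g ≠ 1) (htr : g 0 0 + g 1 1 = 2) : Kt = ⊤ := by
  have hd := det_eq g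
  by_cases hc : g 1 0 = 0
  · have ha : (g 0 0 - 1) * (g 0 0 - 1) = 0 := by
      rw [hc] at hd; linear_combination -hd + g 0 0 * htr
    have ha : g 0 0 = 1 := by
      rcases mul_eq_zero.mp ha with h | h <;> linear_combination h
    have hd1 : g 1 1 = 1 := by linear_combination htr - ha
    have he : g = uu (g 0 1) := by apply ext2 <;> simp [uu, ha, hd1, hc]
    refine gen1 Kt (g 0 1) ?_ (by rw [← he]; exact hg) _ h0 (by simp [ww])
    intro hb
    apply hg1
    apply ext2 <;> simp [ha, hb, hc, hd1]
  · let P : SpecialLinearGroup (Fin 2) (ZMod p) :=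
      ⟨!![g 0 0 - 1, -1 / g 1 0; g 1 0, 0], by
        rw [Matrix.det_fin_two_of]; field_simp; ring⟩
    have h00 : P 0 0 = g 0 0 - 1 := rfl
    have h01 : P 0 1 = -1 / g 1 0 := rfl
    have h10 : P 1 0 = g 1 0 := rfl
    have h11 : P 1 1 = 0 := rfl
    have hT : Kt.comap (MulAut.conj P).toMonoidHom = ⊤ := by
      refine gen1 _ (-1 / g 1 0) (by simp [hc]) ?_ (P⁻¹ * ww 1 (-1) (by ring) * P) ?_ ?_
      · rw [Subgroup.mem_comap]
        change P * uu (-1 / g 1 0) * P⁻¹ ∈ Kt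
        have : P * uu (-1 / g 1 0) * P⁻¹ = g := by
          rw [mul_inv_eq_iff_eq_mul]
          apply ext2 <;> simp only [mul_e, h00, h01, h10, h11] <;> simp [uu] <;> field_simp
          · linear_combination hd - g 0 0 * htr
          · ring
          · linear_combination -htr
        rwa [this]
      · rw [Subgroup.mem_comap]
        change P * (P⁻¹ * ww 1 (-1) (by ring) * P) * P⁻¹ ∈ Kt
        have : P * (P⁻¹ * ww 1 (-1) (by ring) * P) * P⁻¹ = ww 1 (-1) (by ring) := by group
        rwa [this]
      · have e : (P⁻¹ * ww 1 (-1) (by ring) * P : SpecialLinearGroup (Fin 2) (ZMod p)) 1 0 = -(g 1 0 ^ 2 + (g 0 0 - 1) ^ 2) := by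
          simp only [mul_e]
          rw [Matrix.SpecialLinearGroup.SL2_inv_expl]
          simp [ww, h00, h10]
          ring
        rw [e, neg_ne_zero]
        intro h
        apply neg_one_not_square hp
        refine ⟨(g 0 0 - 1) / g 1 0, ?_⟩
        field_simp
        linear_combination -h
    rw [eq_top_iff]
    intro k _
    have : P⁻¹ * k * P ∈ Kt.comap (MulAut.conj P).toMonoidHom := by rw [hT]; trivial
    rw [Subgroup.mem_comap] at this
    change P * (P⁻¹ * k * P) * P⁻¹ ∈ Kt at this
    have e : P * (P⁻¹ * k * P) * P⁻¹ = k := by group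
    rwa [e] at this

lemma gen3 (hp : p % 4 = 3) (Kt : Subgroup (SpecialLinearGroup (Fin 2) (ZMod p)))
    (h0 : ww 1 (-1) (by ring) ∈ Kt) (hm : -1 ∈ Kt) (g : SpecialLinearGroup (Fin 2) (ZMod p))
    (hg : g ∈ Kt) (hg1 : g ≠ 1) (hg2 : g ≠ -1) (htr : (g 0 0 + g 1 1) ^ 2 = 4) : Kt = ⊤ := by
  have h : (g 0 0 + g 1 1 - 2) * (g 0 0 + g 1 1 + 2) = 0 := by linear_combination htr
  rcases mul_eq_zero.mp h with h | h
  · exact gen2 hp Kt h0 g hg hg1 (by linear_combination h)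
  · refine gen2 hp Kt h0 (-g) ?_ ?_ ?_
    · have := mul_mem hm hg
      simpa using this
    · intro h; apply hg2; rw [← h, neg_neg]
    · rw [neg_e, neg_e]; linear_combination -h

end Weil


namespace Weil

open MulAction in
lemma count {Γ X : Type} [Group Γ] [Fintype Γ] [Fintype X] [MulAction Γ X] (e : Γ) (he1 : e ≠ 1)
    (he2 : e ^ 2 = 1) (hfix : ∀ x : X, e • x = x)
    (h2 : ∀ g : Γ, g ≠ 1 → g ≠ e → Nat.card (fixedBy X g) = 2)
    (hst : ∀ x : X, ∃ g : Γ, g ≠ 1 ∧ g ≠ e ∧ g • x = x)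
    (x0 : X) (g0 : Γ) (hg0 : orderOf g0 = 14) (hg0x : g0 • x0 = x0)
    (a b : Γ) (hab : a • x0 ≠ b • x0) (ha : a • x0 ≠ x0) (hb : b • x0 ≠ x0) : False := by
  classical
  set N := Fintype.card Γ with hN
  set n := Fintype.card X with hn
  set r := Fintype.card (orbitRel.Quotient Γ X) with hr
  have burn : 2 * n + 2 * (N - 2) = r * N := by
    have := sum_card_fixedBy_eq_card_orbits_mul_card_group Γ X
    rw [← hr, ← hN] at this
    rw [← this]
    have h3 : ∀ g : Γ, Fintype.card (fixedBy X g) = if g ∈ ({1, e} : Finset Γ) then n else 2 := by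
      intro g
      split_ifs with h
      · rw [hn]
        rw [Finset.mem_insert, Finset.mem_singleton] at h
        apply Fintype.card_congr
        refine (Equiv.subtypeUnivEquiv fun x => ?_)
        rw [mem_fixedBy]
        rcases h with rfl | rfl
        · simp
        · exact hfix x
      · rw [Finset.mem_insert, Finset.mem_singleton, not_or] at h
        rw [← Nat.card_eq_fintype_card, h2 g h.1 h.2]
    have hcard : ({1, e} : Finset Γ).card = 2 := Finset.card_pair he1.symm
    rw [Finset.sum_congr rfl fun g _ => h3 g, Finset.sum_ite, Finset.sum_const, Finset.sum_const,
      Finset.filter_mem_eq_inter, Finset.univ_inter, hcard, Finset.filter_not,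
      Finset.card_sdiff_of_subset (Finset.filter_subset _ _), Finset.filter_mem_eq_inter,
      Finset.univ_inter, hcard, Finset.card_univ, smul_eq_mul, smul_eq_mul, ← hN, mul_comm 2 (N - 2)]
  let o : orbitRel.Quotient Γ X → ℕ := fun ω => Nat.card (orbit Γ ω.out)
  have hsum : n = ∑ ω, o ω := by
    rw [hn, Fintype.card_congr (selfEquivSigmaOrbits Γ X), Fintype.card_sigma]
    refine Finset.sum_congr rfl fun ω _ => ?_
    rw [← Nat.card_eq_fintype_card]
  have hos : ∀ x : X, Nat.card (orbit Γ x) * Nat.card (stabilizer Γ x) = N := by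
    intro x
    rw [Nat.card_eq_fintype_card, Nat.card_eq_fintype_card,
      card_orbit_mul_card_stabilizer_eq_card_group]
  have heo : orderOf e = 2 := by
    have : Fact (Nat.Prime 2) := ⟨by norm_num⟩
    exact orderOf_eq_prime he2 he1
  have hs4 : ∀ x : X, Nat.card (stabilizer Γ x) = 4 ∨ 6 ≤ Nat.card (stabilizer Γ x) := by
    intro x
    have h1 : 2 ∣ Nat.card (stabilizer Γ x) := by
      rw [← heo]
      exact Subgroup.orderOf_dvd_natCard _ (hfix x)
    obtain ⟨g, hg1, hge, hgx⟩ := hst x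
    have h3 : 2 < Nat.card (stabilizer Γ x) := by
      have hsub : ({1, e, g} : Finset Γ) ⊆ Finset.univ.filter (fun k => k ∈ stabilizer Γ x) := by
        intro k hk
        simp only [Finset.mem_insert, Finset.mem_singleton] at hk
        simp only [Finset.mem_filter, Finset.mem_univ, true_and, mem_stabilizer_iff]
        rcases hk with rfl | rfl | rfl
        · simp
        · exact hfix x
        · exact hgx
      have := Finset.card_le_card hsub
      rw [Finset.card_eq_three.mpr ⟨1, e, g, he1.symm, hg1.symm, hge.symm, rfl⟩] at this
      rw [Nat.card_eq_fintype_card, Fintype.card_subtype]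
      exact this
    omega
  have ho4 : ∀ ω, 4 * o ω = N ∨ 6 * o ω ≤ N := by
    intro ω
    have h1 := hos ω.out
    rcases hs4 ω.out with h | h
    · left; rw [h] at h1; simp only [o]; omega
    · right; simp only [o]; nlinarith
  set ω0 : orbitRel.Quotient Γ X := Quotient.mk'' x0 with hω0
  have horb : orbit Γ ω0.out = orbit Γ x0 := by
    have : ω0.out ∈ orbit Γ x0 := by
      rw [← orbitRel_apply]
      exact Quotient.mk_out (s := orbitRel Γ X) x0
    exact orbit_eq_iff.mpr this
  have ho0 : o ω0 = Nat.card (orbit Γ x0) := by simp only [o]; rw [horb]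
  have h14 : 14 * o ω0 ≤ N := by
    have h1 := hos x0
    rw [← ho0] at h1
    have h3 : 14 ∣ Nat.card (stabilizer Γ x0) := by
      rw [← hg0]
      exact Subgroup.orderOf_dvd_natCard _ hg0x
    have h4 : 14 ≤ Nat.card (stabilizer Γ x0) := Nat.le_of_dvd Nat.card_pos h3
    nlinarith
  have h3 : 3 ≤ o ω0 := by
    rw [ho0]
    have hsub : ({x0, a • x0, b • x0} : Finset X) ⊆ Finset.univ.filter (fun k => k ∈ orbit Γ x0) := by
      intro k hk
      simp only [Finset.mem_insert, Finset.mem_singleton] at hk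
      simp only [Finset.mem_filter, Finset.mem_univ, true_and]
      rcases hk with rfl | rfl | rfl
      · exact mem_orbit_self _
      · exact mem_orbit _ _
      · exact mem_orbit _ _
    have := Finset.card_le_card hsub
    rw [Finset.card_eq_three.mpr ⟨x0, a • x0, b • x0, ha.symm, hb.symm, hab, rfl⟩] at this
    rw [Nat.card_eq_fintype_card, Fintype.card_subtype]
    exact this
  have hrpos : 1 ≤ r := Fintype.card_pos_iff.mpr ⟨ω0⟩
  have hsplit : n = o ω0 + ∑ ω ∈ Finset.univ.erase ω0, o ω := by
    rw [hsum, Finset.add_sum_erase _ _ (Finset.mem_univ _)]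
  have hcard1 : (Finset.univ.erase ω0).card = r - 1 := by
    rw [Finset.card_erase_of_mem (Finset.mem_univ _), Finset.card_univ]
  have hNbig : 42 ≤ N := by omega
  by_cases hall : ∀ ω ∈ Finset.univ.erase ω0, 4 * o ω = N
  · have h5 : 4 * ∑ ω ∈ Finset.univ.erase ω0, o ω = (r - 1) * N := by
      rw [Finset.mul_sum, Finset.sum_congr rfl hall, Finset.sum_const, hcard1, smul_eq_mul]
    obtain ⟨k, hk⟩ := Nat.exists_eq_add_of_le hrpos
    rw [hk] at h5 burn
    have h6 : 1 + k - 1 = k := by omega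
    rw [h6] at h5
    obtain ⟨M, hM⟩ := Nat.exists_eq_add_of_le (show 2 ≤ N by omega)
    have h7 : N - 2 = M := by omega
    rw [h7] at burn
    rcases Nat.lt_or_ge k 3 with hk3 | hk3
    · interval_cases k <;> omega
    · nlinarith
  · push Not at hall
    obtain ⟨ω1, hm1, hne⟩ := hall
    have h61 : 6 * o ω1 ≤ N := (ho4 ω1).resolve_left hne
    have h8 : ∑ ω ∈ Finset.univ.erase ω0, o ω =
        o ω1 + ∑ ω ∈ (Finset.univ.erase ω0).erase ω1, o ω := by
      rw [Finset.add_sum_erase _ _ hm1]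
    have hcard2 : ((Finset.univ.erase ω0).erase ω1).card = r - 1 - 1 := by
      rw [Finset.card_erase_of_mem hm1, hcard1]
    have hr2 : 1 ≤ r - 1 := by
      rw [← hcard1]; exact Finset.card_pos.mpr ⟨_, hm1⟩
    have h9 : 4 * ∑ ω ∈ (Finset.univ.erase ω0).erase ω1, o ω ≤ (r - 1 - 1) * N := by
      rw [Finset.mul_sum, ← hcard2, ← smul_eq_mul, ← Finset.sum_const]
      refine Finset.sum_le_sum fun ω _ => ?_
      rcases ho4 ω with h | h <;> omega
    obtain ⟨k, hk⟩ := Nat.exists_eq_add_of_le (show 2 ≤ r by omega)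
    rw [hk] at h9 burn
    have h6 : 2 + k - 1 - 1 = k := by omega
    rw [h6] at h9
    obtain ⟨M, hM⟩ := Nat.exists_eq_add_of_le (show 2 ≤ N by omega)
    have h7 : N - 2 = M := by omega
    rw [h7] at burn
    rcases Nat.lt_or_ge k 1 with hk3 | hk3
    · interval_cases k; omega
    · nlinarith

end Weil


namespace Weil

lemma fix_two {L : Type} [Field L] [IsAlgClosed L] [DecidableEq L] (h2 : (2 : L) ≠ 0)
    (g : GL (Fin 2) L) (hd : (g 0 0 - g 1 1) ^ 2 + 4 * g 0 1 * g 1 0 ≠ 0) :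
    {x : OnePoint L | g • x = x}.ncard = 2 := by
  have hco : ∀ c : L, g • (c : OnePoint L) = c ↔
      g 1 0 * c ^ 2 + (g 1 1 - g 0 0) * c - g 0 1 = 0 := by
    intro c
    rw [← Matrix.GeneralLinearGroup.fixpointPolynomial_aeval_eq_zero_iff]
    simp [Matrix.GeneralLinearGroup.fixpointPolynomial]
  by_cases hc : g 1 0 = 0
  · have hda : g 1 1 - g 0 0 ≠ 0 := by
      intro h
      apply hd
      rw [hc]
      linear_combination (g 1 1 - g 0 0) * h
    have : {x : OnePoint L | g • x = x} =
        {OnePoint.infty, ((g 0 1 / (g 1 1 - g 0 0) : L) : OnePoint L)} := by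
      ext x
      simp only [Set.mem_setOf_eq, Set.mem_insert_iff, Set.mem_singleton_iff]
      cases x with
      | infty => simp [OnePoint.smul_infty_eq_self_iff, hc]
      | coe x =>
        rw [hco, hc]
        simp only [OnePoint.coe_ne_infty, false_or, OnePoint.coe_eq_coe]
        rw [eq_div_iff hda]
        constructor <;> intro h <;> linear_combination h
    rw [this, Set.ncard_pair (OnePoint.infty_ne_coe _)]
  · obtain ⟨s, hs⟩ := IsAlgClosed.exists_pow_nat_eq ((g 0 0 - g 1 1) ^ 2 + 4 * g 0 1 * g 1 0)
      (n := 2) (by norm_num)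
    have hs0 : s ≠ 0 := by
      rintro rfl
      apply hd
      rw [← hs]; simp
    have : {x : OnePoint L | g • x = x} =
        {(((g 0 0 - g 1 1 + s) / (2 * g 1 0) : L) : OnePoint L),
          (((g 0 0 - g 1 1 - s) / (2 * g 1 0) : L) : OnePoint L)} := by
      ext x
      simp only [Set.mem_setOf_eq, Set.mem_insert_iff, Set.mem_singleton_iff]
      cases x with
      | infty => simp [OnePoint.smul_infty_eq_self_iff, hc]
      | coe x =>
        rw [hco]
        simp only [OnePoint.coe_eq_coe]
        rw [eq_div_iff (mul_ne_zero h2 hc), eq_div_iff (mul_ne_zero h2 hc)]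
        have h4 : (4 : L) * g 1 0 ≠ 0 := by
          rw [show (4 : L) = 2 * 2 by norm_num]
          exact mul_ne_zero (mul_ne_zero h2 h2) hc
        have e : (4 * g 1 0) * (g 1 0 * x ^ 2 + (g 1 1 - g 0 0) * x - g 0 1) =
            (x * (2 * g 1 0) - (g 0 0 - g 1 1 + s)) * (x * (2 * g 1 0) - (g 0 0 - g 1 1 - s)) := by
          linear_combination hs
        constructor
        · intro h
          rw [h, mul_zero] at e
          rcases mul_eq_zero.mp e.symm with h | h
          · left; linear_combination h
          · right; linear_combination h
        · intro h
          have : (4 * g 1 0) * (g 1 0 * x ^ 2 + (g 1 1 - g 0 0) * x - g 0 1) = 0 := by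
            rw [e]
            rcases h with h | h <;> rw [h] <;> ring
          exact (mul_eq_zero.mp this).resolve_left h4
    rw [this, Set.ncard_pair]
    rw [Ne, OnePoint.coe_eq_coe, div_left_inj' (mul_ne_zero h2 hc)]
    intro h
    have : 2 * s = 0 := by linear_combination h
    rcases mul_eq_zero.mp this with h | h
    · exact h2 h
    · exact hs0 h

variable {p : ℕ} [Fact p.Prime]

/-- the embedding in GL2 over the algebraic closure -/
noncomputable def phi (p : ℕ) [Fact p.Prime] : SpecialLinearGroup (Fin 2) (ZMod p) →*
    GL (Fin 2) (AlgebraicClosure (ZMod p)) :=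
  Matrix.SpecialLinearGroup.toGL.comp
    (Matrix.SpecialLinearGroup.map (algebraMap (ZMod p) (AlgebraicClosure (ZMod p))))

lemma phi_apply (g : SpecialLinearGroup (Fin 2) (ZMod p)) (i j : Fin 2) :
    phi p g i j = algebraMap (ZMod p) (AlgebraicClosure (ZMod p)) (g i j) := rfl

lemma phi_fix (hp : p % 4 = 3) [DecidableEq (AlgebraicClosure (ZMod p))]
    (g : SpecialLinearGroup (Fin 2) (ZMod p))
    (hg : (g 0 0 + g 1 1) ^ 2 ≠ 4) :
    {x : OnePoint (AlgebraicClosure (ZMod p)) | phi p g • x = x}.ncard = 2 := by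
  apply fix_two
  · intro h
    apply two_ne hp
    apply (algebraMap (ZMod p) (AlgebraicClosure (ZMod p))).injective
    rw [map_zero, map_ofNat]; exact h
  · simp only [phi_apply]
    intro h
    apply hg
    have hd := det_eq g
    have h' : (g 0 0 - g 1 1) ^ 2 + 4 * g 0 1 * g 1 0 = 0 := by
      apply (algebraMap (ZMod p) (AlgebraicClosure (ZMod p))).injective
      have e4 : (algebraMap (ZMod p) (AlgebraicClosure (ZMod p))) 4 = 4 := map_ofNat _ 4
      rw [map_zero, ← h]
      simp [e4]
    linear_combination h' + 4 * hd

lemma one_fix [DecidableEq (AlgebraicClosure (ZMod p))] (x : OnePoint (AlgebraicClosure (ZMod p))) :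
    phi p (-1) • x = x := by
  cases x with
  | infty => rw [OnePoint.smul_infty_eq_self_iff, phi_apply]; simp
  | coe x =>
    rw [← Matrix.GeneralLinearGroup.fixpointPolynomial_aeval_eq_zero_iff]
    simp [Matrix.GeneralLinearGroup.fixpointPolynomial, phi_apply]

lemma gen4 (hp : p % 4 = 3) (Kt : Subgroup (SpecialLinearGroup (Fin 2) (ZMod p)))
    (h0 : ww 1 (-1) (by ring) ∈ Kt) (hm : -1 ∈ Kt)
    (z w : ZMod p) (hzw : z * w = 1) (hz7 : z ^ 7 = 1) (hz1 : z ≠ 1)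
    (ht : tt z w hzw ∈ Kt) (x y : ZMod p) (hxy : x ^ 2 + y ^ 2 = -1)
    (hx : x ≠ 0) (hy : y ≠ 0) (h2 : S2 x y hxy ∈ Kt)
    (hK : ∀ g ∈ Kt, g ≠ 1 → g ≠ -1 → (g 0 0 + g 1 1) ^ 2 ≠ 4) : False := by
  classical
  let L := AlgebraicClosure (ZMod p)
  let _ : MulAction Kt (OnePoint L) := MulAction.compHom _ ((phi p).comp Kt.subtype)
  have hact : ∀ (k : Kt) (P : OnePoint L), k • P = phi p k.1 • P := fun _ _ => rfl
  have hne1 : (1 : SpecialLinearGroup (Fin 2) (ZMod p)) ≠ -1 := by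
    intro h
    have := congrArg (fun g : SpecialLinearGroup (Fin 2) (ZMod p) => g 0 0) h
    simp at this
    apply two_ne hp
    linear_combination this
  let e : Kt := ⟨-1, hm⟩
  have hpm : ∀ k : Kt, k ≠ 1 → k ≠ e → k.1 ≠ 1 ∧ k.1 ≠ -1 := by
    intro k h1 h2
    exact ⟨fun h => h1 (Subtype.ext h), fun h => h2 (Subtype.ext h)⟩
  let S : SubMulAction Kt (OnePoint L) :=
    { carrier := {P | ∃ k : Kt, k ≠ 1 ∧ k ≠ e ∧ k • P = P}
      smul_mem' := by
        rintro c P ⟨k, h1, h2, h3⟩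
        refine ⟨c * k * c⁻¹, ?_, ?_, ?_⟩
        · intro h; apply h1
          have : c⁻¹ * (c * k * c⁻¹) * c = k := by group
          rw [← this, h]; simp
        · intro h; apply h2
          have : c⁻¹ * (c * k * c⁻¹) * c = k := by group
          rw [← this, h]
          apply Subtype.ext
          simp [e]
        · rw [mul_smul, mul_smul, inv_smul_smul, h3] }
  have hfixset : ∀ k : Kt, k ≠ 1 → k ≠ e → {P : OnePoint L | k • P = P}.ncard = 2 := by
    intro k h1 h2
    obtain ⟨h3, h4⟩ := hpm k h1 h2
    exact phi_fix hp k.1 (hK k.1 k.2 h3 h4)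
  have hfin : Set.Finite (S : Set (OnePoint L)) := by
    have : (S : Set (OnePoint L)) ⊆ ⋃ k ∈ {k : Kt | k ≠ 1 ∧ k ≠ e}, {P : OnePoint L | k • P = P} := by
      rintro P ⟨k, h1, h2, h3⟩
      simp only [Set.mem_iUnion]
      exact ⟨k, ⟨h1, h2⟩, h3⟩
    refine Set.Finite.subset (Set.Finite.biUnion (Set.toFinite _) ?_) this
    intro k hk
    apply Set.finite_of_ncard_ne_zero
    rw [hfixset k hk.1 hk.2]
    norm_num
  let _ : Fintype S := hfin.fintype
  let _ : Fintype Kt := Fintype.ofFinite _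
  let t0 : Kt := ⟨tt z w hzw, ht⟩
  let g0 : Kt := e * t0
  have hinf : g0 • (OnePoint.infty : OnePoint L) = OnePoint.infty := by
    have e10 : (g0.1) 1 0 = 0 := by
      change ((-1) * tt z w hzw : SpecialLinearGroup (Fin 2) (ZMod p)) 1 0 = 0
      rw [mul_e]; simp [tt]
    rw [hact, OnePoint.smul_infty_eq_self_iff, phi_apply, e10, map_zero]
  have hw0 : w ≠ 0 := by rintro rfl; simp at hzw
  have hpow : ∀ n, t0 ^ n = ⟨tt (z ^ n) (w ^ n) (by rw [← mul_pow, hzw, one_pow]), by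
      rw [← tt_pow]; exact pow_mem ht n⟩ := by
    intro n
    apply Subtype.ext
    exact tt_pow z w hzw n
  have ho_t : orderOf t0 = 7 := by
    have : Fact (Nat.Prime 7) := ⟨by norm_num⟩
    refine orderOf_eq_prime ?_ ?_
    · rw [hpow]
      apply Subtype.ext
      have hw7 := w7 hp z w hzw hz7 hz1
      apply ext2 <;> simp [tt, hz7, hw7]
    · intro h
      have := congrArg (fun g : Kt => g.1 0 0) h
      simp [t0, tt] at this
      exact hz1 this
  have he1 : e ≠ 1 := fun h => hne1 (congrArg Subtype.val h).symm
  have he2 : e ^ 2 = 1 := by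
    apply Subtype.ext
    change (-1 : SpecialLinearGroup (Fin 2) (ZMod p)) ^ 2 = 1
    simp
  have ho_e : orderOf e = 2 := by
    have : Fact (Nat.Prime 2) := ⟨by norm_num⟩
    exact orderOf_eq_prime he2 he1
  have hcomm : Commute e t0 := by
    apply Subtype.ext
    simp [e]
  have hg14 : orderOf g0 = 14 := by
    rw [hcomm.orderOf_mul_eq_mul_orderOf_of_coprime (by rw [ho_e, ho_t]; norm_num), ho_e, ho_t]
  have hg1 : g0 ≠ 1 := by
    intro h; rw [h, orderOf_one] at hg14; norm_num at hg14
  have hge : g0 ≠ e := by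
    intro h; rw [h, ho_e] at hg14; norm_num at hg14
  let x0 : S := ⟨OnePoint.infty, g0, hg1, hge, hinf⟩
  let a : Kt := ⟨_, h0⟩
  let b : Kt := ⟨_, h2⟩
  have ha : a • (OnePoint.infty : OnePoint L) = ((0 : L) : OnePoint L) := by
    rw [hact, OnePoint.smul_infty_eq_ite]
    have e1 : a.1 0 0 = 0 := rfl
    have e2 : a.1 1 0 = -1 := rfl
    simp only [phi_apply, e1, e2]
    simp
  have hb : b • (OnePoint.infty : OnePoint L) =
      ((algebraMap (ZMod p) L x / algebraMap (ZMod p) L y : L) : OnePoint L) := by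
    rw [hact, OnePoint.smul_infty_eq_ite]
    have e1 : b.1 0 0 = x := rfl
    have e2 : b.1 1 0 = y := rfl
    simp only [phi_apply, e1, e2]
    simp [hy, L]
  have hq : (algebraMap (ZMod p) L x / algebraMap (ZMod p) L y : L) ≠ 0 := by
    simp [hx, hy]
  refine count e he1 he2 (X := S) ?_ ?_ ?_ x0 g0 hg14 ?_ a b ?_ ?_ ?_
  · intro P
    apply Subtype.ext
    exact one_fix P.1
  · intro k h1 h2
    refine Eq.trans ?_ (hfixset k h1 h2)
    rw [← Nat.card_coe_set_eq]
    refine Nat.card_congr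
      { toFun := fun P => ⟨P.1.1, congrArg Subtype.val P.2⟩
        invFun := fun P => ⟨⟨P.1, k, h1, h2, P.2⟩, Subtype.ext P.2⟩
        left_inv := fun P => rfl
        right_inv := fun P => rfl }
  · rintro ⟨P, k, h1, h2, h3⟩
    exact ⟨k, h1, h2, Subtype.ext h3⟩
  · exact Subtype.ext hinf
  · intro h
    have := congrArg Subtype.val h
    change a • (OnePoint.infty : OnePoint L) = b • (OnePoint.infty : OnePoint L) at this
    rw [ha, hb, OnePoint.coe_eq_coe] at this
    exact hq this.symm
  · intro h
    have := congrArg Subtype.val h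
    change a • (OnePoint.infty : OnePoint L) = OnePoint.infty at this
    rw [ha] at this
    exact OnePoint.coe_ne_infty _ this
  · intro h
    have := congrArg Subtype.val h
    change b • (OnePoint.infty : OnePoint L) = OnePoint.infty at this
    rw [hb] at this
    exact OnePoint.coe_ne_infty _ this

lemma gen5 (hp : p % 4 = 3) (z w : ZMod p) (hzw : z * w = 1) (hz7 : z ^ 7 = 1) (hz1 : z ≠ 1)
    (x y : ZMod p) (hxy : x ^ 2 + y ^ 2 = -1) (hx : x ≠ 0) (hy : y ≠ 0) :
    Subgroup.closure {s0 p, s1 z w hzw, pr (S2 x y hxy)} = ⊤ := by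
  set C := Subgroup.closure {s0 p, s1 z w hzw, pr (S2 x y hxy)} with hC
  set Kt := C.comap (QuotientGroup.mk' (Subgroup.center (SpecialLinearGroup (Fin 2) (ZMod p))))
    with hKt
  have hmem : ∀ g, g ∈ Kt ↔ pr g ∈ C := fun g => Iff.rfl
  have m0 : s0 p ∈ C := Subgroup.subset_closure (by simp)
  have m1 : s1 z w hzw ∈ C := Subgroup.subset_closure (by simp)
  have m2 : pr (S2 x y hxy) ∈ C := Subgroup.subset_closure (by simp)
  have hm : -1 ∈ Kt := by
    rw [hmem, pr_neg]; exact one_mem C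
  have ht : tt z w hzw ∈ Kt := by
    rw [hmem]
    have h := inv_mem (mul_mem m0 m1)
    rw [s0_mul_s1] at h
    convert h using 1
    change _ = pr (_)⁻¹
    congr 1
    rw [eq_inv_iff_mul_eq_one]
    apply ext2 <;> simp only [mul_e] <;> simp [tt, hzw]
    rw [mul_comm, hzw]
  have htop : Kt = ⊤ := by
    by_contra hne
    apply gen4 hp Kt m0 hm z w hzw hz7 hz1 ht x y hxy hx hy m2
    intro g hg h1 h2 h3
    exact hne (gen3 hp Kt m0 hm g hg h1 h2 h3)
  rw [eq_top_iff]
  intro g _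
  induction g using QuotientGroup.induction_on with
  | H k =>
    have : k ∈ Kt := by rw [htop]; trivial
    exact this

end Weil


namespace Weil
variable {p : ℕ} [Fact p.Prime]

lemma exists_z (h : p % 7 = 1) : ∃ z w : ZMod p, z * w = 1 ∧ z ^ 7 = 1 ∧ z ≠ 1 := by
  have : Fact (Nat.Prime 7) := ⟨by norm_num⟩
  have hd : 7 ∣ Fintype.card (ZMod p)ˣ := by
    rw [ZMod.card_units]; omega
  obtain ⟨u, hu⟩ := exists_prime_orderOf_dvd_card 7 hd
  refine ⟨u, (u⁻¹ : (ZMod p)ˣ), Units.mul_inv u, ?_, ?_⟩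
  · rw [← hu, ← Units.val_pow_eq_pow_val, pow_orderOf_eq_one, Units.val_one]
  · intro h1
    have : u = 1 := Units.ext h1
    rw [this, orderOf_one] at hu
    norm_num at hu

lemma exists_xy (hp : p % 4 = 3) : ∃ x y : ZMod p, x ^ 2 + y ^ 2 = -1 ∧ x ≠ 0 ∧ y ≠ 0 := by
  obtain ⟨x, y, hxy⟩ := ZMod.sq_add_sq p (-1)
  refine ⟨x, y, hxy, ?_, ?_⟩
  · rintro rfl
    exact neg_one_not_square hp ⟨y, by linear_combination -hxy⟩
  · rintro rfl
    exact neg_one_not_square hp ⟨x, by linear_combination -hxy⟩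

lemma chi_conj (hp : p % 4 = 3) (g h : ProjectiveSpecialLinearGroup (Fin 2) (ZMod p)) :
    chi hp (g * h * g⁻¹) = chi hp h := by
  unfold chi
  rw [map_mul, LinearMap.trace_mul_comm, ← map_mul]
  congr 2
  group

end Weil

/-- (Theorem `t:complbigwythoff`.) For every `N` there is a prime
`p ≡ -1 (mod 4)`, `p ≡ 1 (mod 7)`, such that `G = PSL(2,p)` is a string C-group
(with generators `s₀,s₁,s₂`) whose vertex stabilizer `H = ⟨s₀,s₁⟩` is dihedral of
order 14, together with an irreducible complex character `χ` of `G` with `χ ≠ χ̄` and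
`⟨Ind_H^G 1, χ⟩ ≥ (p-1)/28 - 13/14 > N`; i.e. there are abstract regular polytopes
with a pure realization of complex type of arbitrarily large essential Wythoff
dimension. -/
theorem stmt10 (N : ℕ) :
    ∃ p : ℕ, p.Prime ∧ p % 4 = 3 ∧ p % 7 = 1 ∧
      ∃ s₀ s₁ s₂ : ProjectiveSpecialLinearGroup (Fin 2) (ZMod p),
        -- string C-group conditions:
        (s₀ ≠ 1 ∧ s₀ ^ 2 = 1) ∧ (s₁ ≠ 1 ∧ s₁ ^ 2 = 1) ∧ (s₂ ≠ 1 ∧ s₂ ^ 2 = 1) ∧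
        s₀ * s₂ = s₂ * s₀ ∧
        Subgroup.closure {s₀, s₁} ⊓ Subgroup.closure {s₁, s₂}
          = Subgroup.closure {s₁} ∧
        Subgroup.closure {s₀, s₁, s₂} = ⊤ ∧
        -- the vertex stabilizer `H = ⟨s₀,s₁⟩` is dihedral of order 14:
        Nat.card (Subgroup.closure {s₀, s₁}) = 14 ∧
        Nonempty ((Subgroup.closure {s₀, s₁}) ≃* DihedralGroup 7) ∧
        -- an irreducible complex character of large multiplicity in `Ind_H^G 1`:
        ∃ χ : ProjectiveSpecialLinearGroup (Fin 2) (ZMod p) → ℂ,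
          IsIrrChar _ χ ∧
          χ ≠ (fun g => (starRingEnd ℂ) (χ g)) ∧
          ∃ m : ℕ,
            -- `m = ⟨Ind_H^G 1, χ⟩`, the multiplicity, computed against the
            -- permutation character of `G` on `G/H`:
            (m : ℂ) = ipCF'
              (fun g => (Nat.card
                {x : _ ⧸ Subgroup.closure {s₀, s₁} // g • x = x} : ℂ)) χ ∧
            ((p : ℝ) - 1) / 28 - 13 / 14 ≤ (m : ℝ) ∧
            (N : ℝ) < ((p : ℝ) - 1) / 28 - 13 / 14 := by
  classical
  obtain ⟨p, hgt, hprime, hmod⟩ := Nat.forall_exists_prime_gt_and_modEq (28 * N + 1000)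
    (q := 28) (a := 15) (by norm_num) (by norm_num)
  have hmod' : p % 28 = 15 := hmod
  have hp : p % 4 = 3 := by omega
  have hp7 : p % 7 = 1 := by omega
  have : Fact p.Prime := ⟨hprime⟩
  obtain ⟨z, w, hzw, hz7, hz1⟩ := Weil.exists_z (p := p) hp7
  obtain ⟨x, y, hxy, hx, hy⟩ := Weil.exists_xy (p := p) hp
  refine ⟨p, hprime, hp, hp7, Weil.s0 p, Weil.s1 z w hzw, Weil.pr (Weil.S2 x y hxy),
    ⟨Weil.ww_ne _ _ _, Weil.ww_sq _ _ _⟩, ⟨Weil.ww_ne _ _ _, Weil.ww_sq _ _ _⟩,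
    ⟨Weil.S2_ne x y hxy hy, Weil.S2_sq x y hxy⟩, Weil.s0_s2 x y hxy,
    Weil.intersect hp z w hzw hz7 hz1 x y hxy hx hy,
    Weil.gen5 hp z w hzw hz7 hz1 x y hxy hx hy,
    Weil.cardH hp z w hzw hz7 hz1, ⟨(Weil.dhEquiv hp z w hzw hz7 hz1).symm⟩,
    Weil.chi hp, Weil.chi_irr hp, Weil.chi_nonreal hp, ?_⟩
  let _ : Fintype (ProjectiveSpecialLinearGroup (Fin 2) (ZMod p)) := Fintype.ofFinite _
  let _ : Fintype (Subgroup.closure {Weil.s0 p, Weil.s1 z w hzw}) := Fintype.ofFinite _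
  rw [Weil.frob _ _ (Weil.chi_conj hp), Weil.cardH hp z w hzw hz7 hz1,
    Weil.sumH hp z w hzw hz7 hz1]
  obtain ⟨k, hk⟩ : ∃ k, p = 28 * k + 15 := ⟨p / 28, by omega⟩
  have hkN : N + 1 ≤ k := by omega
  have hkN' : (N : ℝ) + 1 ≤ k := by exact_mod_cast hkN
  have hpc : (p : ℂ) = 28 * k + 15 := by rw [hk]; push_cast; ring
  have hpr : (p : ℝ) = 28 * k + 15 := by rw [hk]; push_cast; ring
  rcases Weil.eps_pm hp with h | h
  · refine ⟨k + 1, ?_, ?_, ?_⟩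
    · rw [h, hpc]; push_cast; ring
    · rw [hpr]; push_cast; linarith
    · rw [hpr]; linarith
  · refine ⟨k, ?_, ?_, ?_⟩
    · rw [h, hpc]; push_cast; ring
    · rw [hpr]; linarith
    · rw [hpr]; linarith
end
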